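/- Let k : (0,∞) → [0,∞) be nonincreasing and lower semicontinuous, let 1 < p < ∞, and let σ be a locally finite positive Borel measure on ℝ^n which is doubling and such that the pair (k,σ) satisfies the LBO condition. Then there exist constants C₁, C₂ > 0, independent of μ, such that for every positive (locally finite) Borel measure μ on ℝ^n, C₁ ℰ_{k,σ}[μ] ≤ ∫_{ℝ^n} 𝒲_{k,σ}[μ](x) dμ(x) ≤ C₂ ℰ_{k,σ}[μ], where ℰ_{k,σ}[μ] = ∫_{ℝ^n} (T_k[μ](x))^{p'} dσ(x). -/

import Mathlib

open MeasureTheory ENNReal Set Metric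
open scoped Classical ENNReal NNReal

noncomputable section

/-- We model `ℝ^n` as `EuclideanSpace ℝ (Fin n)`. -/
abbrev Euc (n : ℕ) := EuclideanSpace ℝ (Fin n)

/-- `k̄(r)(x) = (1/σ(B(x,r))) ∫_0^r k(s) σ(B(x,s)) ds/s`. -/
def kbar (n : ℕ) (σ : Measure (Euc n)) (k : ℝ → ℝ) (r : ℝ) (x : Euc n) : ℝ≥0∞ :=
  (σ (ball x r))⁻¹ * ∫⁻ s in Ioo (0:ℝ) r, ENNReal.ofReal (k s / s) * σ (ball x s)

/-- `σ` is a doubling measure: `σ(B(x,2r)) ≤ C₀ σ(B(x,r))` for all `x`, `r > 0`. -/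
def Doubling (n : ℕ) (σ : Measure (Euc n)) : Prop :=
  ∃ C₀ : ℝ, 0 < C₀ ∧ ∀ (x : Euc n) (r : ℝ), 0 < r →
    σ (ball x (2 * r)) ≤ ENNReal.ofReal C₀ * σ (ball x r)

/-- The pair `(k,σ)` satisfies the logarithmic bounded oscillation (LBO) condition:
`sup_{y ∈ B(x,r)} k̄(r)(y) ≤ A inf_{y ∈ B(x,r)} k̄(r)(y)` uniformly in `x`, `r`. -/
def LBO (n : ℕ) (σ : Measure (Euc n)) (k : ℝ → ℝ) : Prop :=
  ∃ A : ℝ, 0 < A ∧ ∀ (x : Euc n) (r : ℝ), 0 < r →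
    ∀ y ∈ ball x r, ∀ z ∈ ball x r, kbar n σ k r y ≤ ENNReal.ofReal A * kbar n σ k r z

/-- The continuous Wolff potential
`𝒲_{k,σ}[μ](x) = ∫_0^∞ k(r) σ(B(x,r)) (∫_{B(x,r)} k̄(r)(y) dμ(y))^{p'-1} dr/r`. -/
def WolffC (n : ℕ) (σ : Measure (Euc n)) (k : ℝ → ℝ) (p : ℝ) (μ : Measure (Euc n))
    (x : Euc n) : ℝ≥0∞ :=
  ∫⁻ r in Ioi (0:ℝ), ENNReal.ofReal (k r / r) * σ (ball x r) *
    (∫⁻ y in ball x r, kbar n σ k r y ∂μ) ^ (p / (p - 1) - 1)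

/-- The energy `ℰ_{k,σ}[μ] = ∫ (T_k[μ](x))^{p'} dσ(x)`, where
`T_k[μ](x) = ∫ k(|x-y|) dμ(y)` and `p' = p/(p-1)`. -/
def energyC (n : ℕ) (σ : Measure (Euc n)) (k : ℝ → ℝ) (p : ℝ) (μ : Measure (Euc n)) :
    ℝ≥0∞ :=
  ∫⁻ x, (∫⁻ y, ENNReal.ofReal (k (dist x y)) ∂μ) ^ (p / (p - 1)) ∂σ

/-! ### Generic lemmas -/

/-- dyadic ball -/
def Bl {n : ℕ} (x : Euc n) (j : ℤ) : Set (Euc n) := ball x ((2:ℝ)^j)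

lemma two_zpow_pos (j : ℤ) : (0:ℝ) < (2:ℝ)^j := by positivity

lemma two_zpow_succ (j : ℤ) : (2:ℝ)^(j+1) = 2 * (2:ℝ)^j := by
  rw [zpow_add₀ (by norm_num)]; ring

lemma two_zpow_mono {i j : ℤ} (h : i ≤ j) : (2:ℝ)^i ≤ (2:ℝ)^j :=
  zpow_le_zpow_right₀ (by norm_num) h

lemma measurableSet_Bl {n : ℕ} (x : Euc n) (j : ℤ) : MeasurableSet (Bl x j) := measurableSet_ball

lemma mem_Bl_comm {n : ℕ} {x z : Euc n} {j : ℤ} : x ∈ Bl z j ↔ z ∈ Bl x j := by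
  simp only [Bl, mem_ball, dist_comm]

lemma mem_Bl {n : ℕ} {x z : Euc n} {j : ℤ} : x ∈ Bl z j ↔ dist x z < (2:ℝ)^j := Iff.rfl

lemma self_mem_Bl {n : ℕ} (x : Euc n) (j : ℤ) : x ∈ Bl x j := by
  simp [mem_Bl, two_zpow_pos]

lemma Bl_mono {n : ℕ} (x : Euc n) {i j : ℤ} (h : i ≤ j) : Bl x i ⊆ Bl x j :=
  ball_subset_ball (two_zpow_mono h)

lemma mem_Bl_trans {n : ℕ} {x y z : Euc n} {i j : ℤ} (h1 : x ∈ Bl y i) (h2 : y ∈ Bl z j) (k : ℤ)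
    (hi : i + 1 ≤ k) (hj : j + 1 ≤ k) : x ∈ Bl z k := by
  rw [mem_Bl] at *
  have := two_zpow_mono hi
  have := two_zpow_mono hj
  rw [two_zpow_succ] at *
  linarith [dist_triangle x y z]

lemma Bl_subset {n : ℕ} {x z : Euc n} {i j : ℤ} (h : x ∈ Bl z j) (k : ℤ)
    (hi : i + 1 ≤ k) (hj : j + 1 ≤ k) : Bl x i ⊆ Bl z k :=
  fun _ hw => mem_Bl_trans hw h k hi hj

lemma measurableSet_BlProd (n : ℕ) (j : ℤ) :
    MeasurableSet {w : Euc n × Euc n | w.2 ∈ Bl w.1 j} := by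
  simp only [mem_Bl]
  exact measurableSet_lt (by fun_prop) measurable_const

lemma setLIntegral_Bl {n : ℕ} (μ : Measure (Euc n)) (x : Euc n) (j : ℤ) (f : Euc n → ℝ≥0∞) :
    ∫⁻ z in Bl x j, f z ∂μ =
      ∫⁻ z, ({w : Euc n × Euc n | w.2 ∈ Bl w.1 j}.indicator (fun w => f w.2)) (x, z) ∂μ := by
  rw [← lintegral_indicator (measurableSet_Bl x j)]
  rfl

lemma measurable_setLIntegral_Bl {n : ℕ} (μ : Measure (Euc n)) [SFinite μ] (j : ℤ)
    {f : Euc n → Euc n → ℝ≥0∞} (hf : Measurable (Function.uncurry f)) :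
    Measurable fun x => ∫⁻ z in Bl x j, f x z ∂μ := by
  have : (fun x => ∫⁻ z in Bl x j, f x z ∂μ) = fun x =>
      ∫⁻ z, ({w : Euc n × Euc n | w.2 ∈ Bl w.1 j}.indicator (Function.uncurry f)) (x, z) ∂μ := by
    ext x
    rw [← lintegral_indicator (measurableSet_Bl x j)]
    rfl
  rw [this]
  exact (hf.indicator (measurableSet_BlProd n j)).lintegral_prod_right'

lemma measurable_Bl {n : ℕ} (μ : Measure (Euc n)) [SFinite μ] (j : ℤ) :
    Measurable fun x => μ (Bl x j) := by
  have := measurable_setLIntegral_Bl μ j (f := fun _ _ => 1) measurable_const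
  simpa using this

lemma swap_Bl {n : ℕ} (μ ν : Measure (Euc n)) [SFinite μ] [SFinite ν] (j : ℤ)
    {f : Euc n → Euc n → ℝ≥0∞} (hf : Measurable (Function.uncurry f)) :
    ∫⁻ x, ∫⁻ z in Bl x j, f x z ∂ν ∂μ = ∫⁻ z, ∫⁻ x in Bl z j, f x z ∂μ ∂ν := by
  have h1 : ∀ x, ∫⁻ z in Bl x j, f x z ∂ν =
      ∫⁻ z, ({w : Euc n × Euc n | w.2 ∈ Bl w.1 j}.indicator (Function.uncurry f)) (x, z) ∂ν := by
    intro x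
    rw [← lintegral_indicator (measurableSet_Bl x j)]
    rfl
  have h2 : ∀ z, ∫⁻ x in Bl z j, f x z ∂μ =
      ∫⁻ x, ({w : Euc n × Euc n | w.2 ∈ Bl w.1 j}.indicator (Function.uncurry f)) (x, z) ∂μ := by
    intro z
    rw [← lintegral_indicator (measurableSet_Bl z j)]
    congr 1
    ext x
    simp only [indicator, mem_ofPred_eq, mem_Bl_comm (x := x) (z := z), Function.uncurry]
  simp_rw [h1, h2]
  exact lintegral_lintegral_swap
    (f := fun x z => ({w : Euc n × Euc n | w.2 ∈ Bl w.1 j}.indicator (Function.uncurry f)) (x, z))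
    (hf.indicator (measurableSet_BlProd n j)).aemeasurable

/-- Jensen, convex version -/
lemma jensen_convex {α : Type*} [MeasurableSpace α] (ν : Measure α) {f : α → ℝ≥0∞}
    (hf : AEMeasurable f ν) {q : ℝ} (hq : 1 < q) :
    (∫⁻ x, f x ∂ν) ^ q ≤ ν univ ^ (q - 1) * ∫⁻ x, f x ^ q ∂ν := by
  have hq0 : q ≠ 0 := by linarith
  have h := lintegral_mul_norm_pow_le (μ := ν) (f := fun x => f x ^ q) (g := fun _ => 1)
    (hf.pow_const q) aemeasurable_const (p := 1/q) (q := 1 - 1/q) (by positivity)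
    (by rw [sub_nonneg, div_le_one (by linarith)]; linarith) (by ring)
  simp only [one_rpow, mul_one, ← ENNReal.rpow_mul, mul_one_div_cancel hq0, ENNReal.rpow_one,
    lintegral_one] at h
  calc (∫⁻ x, f x ∂ν) ^ q ≤ ((∫⁻ x, f x ^ q ∂ν) ^ (1/q) * ν univ ^ (1 - 1/q)) ^ q := by gcongr
    _ = _ := by
      rw [ENNReal.mul_rpow_of_nonneg _ _ (by linarith), ← ENNReal.rpow_mul, ← ENNReal.rpow_mul,
        one_div_mul_cancel hq0, ENNReal.rpow_one, mul_comm, sub_mul, one_div_mul_cancel hq0, one_mul]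

/-- Jensen, concave version -/
lemma jensen_concave {α : Type*} [MeasurableSpace α] (ν : Measure α) {f : α → ℝ≥0∞}
    (hf : AEMeasurable f ν) {r : ℝ} (hr0 : 0 ≤ r) (hr : r ≤ 1) :
    ∫⁻ x, f x ^ r ∂ν ≤ ν univ ^ (1 - r) * (∫⁻ x, f x ∂ν) ^ r := by
  have h := lintegral_mul_norm_pow_le (μ := ν) (f := f) (g := fun _ => 1)
    hf aemeasurable_const (p := r) (q := 1 - r) hr0 (by linarith) (by ring)
  simp only [one_rpow, mul_one, lintegral_one] at h
  rwa [mul_comm]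

/-- layer cake for a single number -/
lemma layer_number (y : ℝ≥0∞) {r : ℝ} (hr : 0 < r) :
    y ^ r = ENNReal.ofReal r * ∫⁻ t in Ioi (0:ℝ),
      (if ENNReal.ofReal t < y then 1 else 0) * ENNReal.ofReal (t ^ (r - 1)) := by
  have key : ∀ c : ℝ≥0, (c:ℝ≥0∞) ^ r = ENNReal.ofReal r * ∫⁻ t in Ioi (0:ℝ),
      (if ENNReal.ofReal t < c then 1 else 0) * ENNReal.ofReal (t ^ (r - 1)) := by
    intro c
    have h := lintegral_rpow_eq_lintegral_meas_lt_mul (Measure.dirac ()) (f := fun _ => (c:ℝ))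
      (Filter.Eventually.of_forall fun _ => c.2) aemeasurable_const hr
    simp only [lintegral_dirac] at h
    rw [← ENNReal.ofReal_coe_nnreal, ENNReal.ofReal_rpow_of_nonneg (NNReal.coe_nonneg c) hr.le, h]
    congr 1
    refine setLIntegral_congr_fun measurableSet_Ioi fun t ht => ?_
    simp only [ENNReal.ofReal_coe_nnreal]
    by_cases htc : t < c
    · rw [if_pos]
      · simp [htc]
      · rwa [← ENNReal.ofReal_coe_nnreal, ENNReal.ofReal_lt_ofReal_iff_of_nonneg (le_of_lt ht)]
    · rw [if_neg]
      · simp [htc]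
      · rwa [← ENNReal.ofReal_coe_nnreal, ENNReal.ofReal_lt_ofReal_iff_of_nonneg (le_of_lt ht)]
  by_cases hy : y = ∞
  · subst hy
    rw [ENNReal.top_rpow_of_pos hr]
    symm
    rw [eq_top_iff]
    refine ENNReal.le_of_forall_nnreal_lt fun c _ => ?_
    have h2 : ((c ^ (1/r) : ℝ≥0) : ℝ≥0∞) ^ r = c := by
      rw [ENNReal.coe_rpow_of_nonneg _ (by positivity), ← ENNReal.rpow_mul, one_div_mul_cancel hr.ne',
        ENNReal.rpow_one]
    rw [← h2, key]
    gcongr with t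
    split_ifs <;> simp_all
  · lift y to ℝ≥0 using hy
    exact key y

/-- power of a finite sum, `q ≥ 1` -/
lemma exists_median (s : Finset ℤ) (a : ℤ → ℝ≥0∞) (ha : ∀ i ∈ s, a i ≠ ∞)
    (hS : ∑ i ∈ s, a i ≠ 0) : ∃ j ∈ s, (∑ i ∈ s, a i) / 2 ≤ ∑ i ∈ s with i ≤ j, a i ∧
      (∑ i ∈ s, a i) / 2 ≤ ∑ i ∈ s with j ≤ i, a i := by
  have hfin : ∑ i ∈ s, a i ≠ ∞ := by simpa using ha
  have hne : s.Nonempty := by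
    by_contra h
    rw [Finset.not_nonempty_iff_eq_empty] at h
    simp [h] at hS
  set t := s.filter fun j => (∑ i ∈ s, a i) / 2 ≤ ∑ i ∈ s with i ≤ j, a i with ht
  have htne : t.Nonempty := by
    refine ⟨s.max' hne, ?_⟩
    rw [ht, Finset.mem_filter]
    refine ⟨s.max'_mem hne, ?_⟩
    rw [Finset.filter_true_of_mem fun i hi => s.le_max' i hi]
    exact ENNReal.half_le_self
  have hm := t.min'_mem htne
  set j := t.min' htne
  have hm' := hm
  rw [ht, Finset.mem_filter] at hm
  refine ⟨j, hm.1, hm.2, ?_⟩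
  have hlt : ∑ i ∈ s with i < j, a i ≤ (∑ i ∈ s, a i) / 2 := by
    by_contra! hcon
    have hne2 : (s.filter (· < j)).Nonempty := by
      by_contra h
      rw [Finset.not_nonempty_iff_eq_empty] at h
      simp [h] at hcon
    have h1 := (s.filter (· < j)).max'_mem hne2
    set l := (s.filter (· < j)).max' hne2 with hl
    rw [Finset.mem_filter] at h1
    have : l ∈ t := by
      rw [ht, Finset.mem_filter]
      refine ⟨h1.1, hcon.le.trans (Finset.sum_le_sum_of_subset ?_)⟩
      intro i hi
      have := (s.filter (· < j)).le_max' i hi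
      rw [Finset.mem_filter] at hi ⊢
      exact ⟨hi.1, this⟩
    exact absurd (t.min'_le l this) (not_le.mpr h1.2)
  have hsplit : ∑ i ∈ s, a i = ∑ i ∈ s with i < j, a i + ∑ i ∈ s with j ≤ i, a i := by
    rw [← Finset.sum_filter_add_sum_filter_not s (· < j)]
    simp
  by_contra! hcon
  have : ∑ i ∈ s, a i < (∑ i ∈ s, a i) / 2 + (∑ i ∈ s, a i) / 2 := by
    calc ∑ i ∈ s, a i = ∑ i ∈ s with i < j, a i + ∑ i ∈ s with j ≤ i, a i := hsplit
      _ < _ := ENNReal.add_lt_add_of_le_of_lt (ne_top_of_le_ne_top (ENNReal.div_ne_top hfin (by simp)) hlt) hlt hcon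
  rw [ENNReal.add_halves] at this
  exact lt_irrefl _ this

lemma sum_rpow_le_small (s : Finset ℤ) (a : ℤ → ℝ≥0∞) (ha : ∀ i ∈ s, a i ≠ ∞) {q : ℝ}
    (hq : 1 < q) : (∑ i ∈ s, a i) ^ q ≤ 2 ^ q *
      ∑ j ∈ s, a j * (∑ i ∈ s with i ≤ j, a i) ^ (q - 1) := by
  by_cases hS : ∑ i ∈ s, a i = 0
  · rw [hS, ENNReal.zero_rpow_of_pos (by linarith)]; exact zero_le
  obtain ⟨j, hj, h1, h2⟩ := exists_median s a ha hS
  set S := ∑ i ∈ s, a i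
  have hfin : S ≠ ∞ := by simpa [S] using ha
  calc S ^ q = 2 ^ q * ((S / 2) * (S / 2) ^ (q - 1)) := by
        have : (S/2) * (S / 2) ^ (q - 1) = (S/2) ^ q := by
          conv_lhs => enter [1]; rw [← ENNReal.rpow_one (S/2)]
          rw [← ENNReal.rpow_add_of_nonneg _ _ (by linarith) (by linarith)]
          congr 1; ring
        rw [this, ← ENNReal.mul_rpow_of_nonneg _ _ (by linarith), ENNReal.mul_div_cancel (by simp) (by simp)]
    _ ≤ 2 ^ q * ∑ l ∈ s with j ≤ l, a l * (∑ i ∈ s with i ≤ l, a i) ^ (q - 1) := by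
        gcongr
        calc (S / 2) * (S / 2) ^ (q - 1) ≤ (∑ i ∈ s with j ≤ i, a i) * (S / 2) ^ (q - 1) := by gcongr
          _ = ∑ l ∈ s with j ≤ l, a l * (S/2) ^ (q - 1) := by rw [Finset.sum_mul]
          _ ≤ _ := by
            refine Finset.sum_le_sum fun l hl => ?_
            gcongr
            refine h1.trans (Finset.sum_le_sum_of_subset ?_)
            intro i hi
            rw [Finset.mem_filter] at *
            exact ⟨hi.1, hi.2.trans hl.2⟩
    _ ≤ _ := by
        gcongr
        exact Finset.filter_subset _ _

lemma sq_sum_le (s : Finset ℤ) (a : ℤ → ℝ≥0∞) :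
    (∑ i ∈ s, a i) * (∑ i ∈ s, a i) ≤ 2 * ∑ j ∈ s, a j * ∑ i ∈ s with i ≤ j, a i := by
  rw [Finset.sum_mul_sum]
  calc ∑ i ∈ s, ∑ j ∈ s, a i * a j ≤
      ∑ i ∈ s, ∑ j ∈ s, ((if j ≤ i then a i * a j else 0) + (if i ≤ j then a i * a j else 0)) := by
        refine Finset.sum_le_sum fun i _ => Finset.sum_le_sum fun j _ => ?_
        rcases le_total i j with h | h <;> simp [h]
    _ = ∑ i ∈ s, ∑ j ∈ s, (if j ≤ i then a i * a j else 0) +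
        ∑ i ∈ s, ∑ j ∈ s, (if i ≤ j then a i * a j else 0) := by
        simp_rw [Finset.sum_add_distrib]
    _ = ∑ i ∈ s, ∑ j ∈ s, (if j ≤ i then a i * a j else 0) +
        ∑ i ∈ s, ∑ j ∈ s, (if j ≤ i then a i * a j else 0) := by
        congr 1
        rw [Finset.sum_comm]
        simp_rw [mul_comm]
    _ = _ := by
        rw [two_mul]
        simp_rw [Finset.sum_filter, Finset.mul_sum, mul_ite, mul_zero]

lemma sum_rpow_le_large (s : Finset ℤ) (a : ℤ → ℝ≥0∞) (ha : ∀ i ∈ s, a i ≠ ∞) {q : ℝ}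
    (hq : 2 < q) : (∑ i ∈ s, a i) ^ q ≤ 2 ^ q * (2 *
      ∑ j ∈ s, a j * (∑ i ∈ s with i ≤ j, a i) * (∑ i ∈ s with j ≤ i, a i) ^ (q - 2)) := by
  by_cases hS : ∑ i ∈ s, a i = 0
  · rw [hS, ENNReal.zero_rpow_of_pos (by linarith)]; exact zero_le
  obtain ⟨j, hj, h1, h2⟩ := exists_median s a ha hS
  set S := ∑ i ∈ s, a i
  have hfin : S ≠ ∞ := by simpa [S] using ha
  calc S ^ q = 2 ^ q * ((S / 2) * (S / 2) * (S / 2) ^ (q - 2)) := by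
        have : (S/2) * (S/2) * (S / 2) ^ (q - 2) = (S/2) ^ q := by
          rw [← sq, ← ENNReal.rpow_two, ← ENNReal.rpow_add_of_nonneg _ _ (by linarith) (by linarith)]
          congr 1; ring
        rw [this, ← ENNReal.mul_rpow_of_nonneg _ _ (by linarith), ENNReal.mul_div_cancel (by simp) (by simp)]
    _ ≤ 2 ^ q * (2 * ∑ l ∈ s with l ≤ j, a l * (∑ i ∈ s with i ≤ l, a i) *
          (∑ i ∈ s with l ≤ i, a i) ^ (q - 2)) := by
        refine mul_le_mul' le_rfl ?_
        calc (S / 2) * (S / 2) * (S / 2) ^ (q - 2)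
            ≤ (∑ i ∈ s with i ≤ j, a i) * (∑ i ∈ s with i ≤ j, a i) * (S / 2) ^ (q - 2) := by gcongr
          _ ≤ (2 * ∑ l ∈ s with l ≤ j, a l * ∑ i ∈ (s.filter (· ≤ j)) with i ≤ l, a i) *
              (S / 2) ^ (q - 2) := by
              exact mul_le_mul' (sq_sum_le _ a) le_rfl
          _ = 2 * ∑ l ∈ s with l ≤ j, a l * (∑ i ∈ (s.filter (· ≤ j)) with i ≤ l, a i) *
              (S / 2) ^ (q - 2) := by rw [mul_assoc, Finset.sum_mul]
          _ ≤ _ := by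
            gcongr with l hl
            · exact Finset.filter_subset _ _
            refine h2.trans (Finset.sum_le_sum_of_subset ?_)
            intro i hi
            rw [Finset.mem_filter] at *
            exact ⟨hi.1, hl.2.trans hi.2⟩
    _ ≤ _ := by
        gcongr
        exact Finset.filter_subset _ _

/-! ### Doubling measures and the maximal function -/

structure Dbl {n : ℕ} (σ : Measure (Euc n)) (D : ℝ≥0∞) : Prop where
  one_le : 1 ≤ D
  ne_top : D ≠ ∞
  pos : ∀ x j, σ (Bl x j) ≠ 0
  fin : ∀ x j, σ (Bl x j) ≠ ∞
  dbl : ∀ x (j : ℤ), σ (Bl x (j+1)) ≤ D * σ (Bl x j)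

namespace Dbl

variable {n : ℕ} {σ : Measure (Euc n)} {D : ℝ≥0∞}

lemma shift (h : Dbl σ D) (x : Euc n) (j : ℤ) (a : ℕ) : σ (Bl x (j + a)) ≤ D ^ a * σ (Bl x j) := by
  induction a with
  | zero => simp
  | succ a ih =>
    have := h.dbl x (j + a)
    push_cast
    rw [← add_assoc]
    refine this.trans ?_
    rw [pow_succ', mul_assoc]
    gcongr

lemma comp (h : Dbl σ D) {x z : Euc n} {j : ℤ} (a : ℕ) (hxz : x ∈ Bl z (j + a)) :
    σ (Bl x j) ≤ D ^ (a+1) * σ (Bl z j) := by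
  refine (measure_mono ?_).trans (h.shift z j (a+1))
  apply Bl_subset hxz <;> push_cast <;> omega

lemma inv_comp (h : Dbl σ D) {x z : Euc n} {j : ℤ} (a : ℕ) (hxz : x ∈ Bl z (j + a)) :
    (σ (Bl x j))⁻¹ ≤ D ^ (a+1) * (σ (Bl z j))⁻¹ := by
  have := h.comp a (mem_Bl_comm.1 hxz)
  rw [ENNReal.inv_le_iff_inv_le, ENNReal.mul_inv (Or.inr (by simp [h.pos])) (Or.inr (by simp [h.fin])), inv_inv, ← ENNReal.div_eq_inv_mul]
  exact ENNReal.div_le_of_le_mul' this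

/-- maximal function -/
def _root_.Mx {n : ℕ} (σ : Measure (Euc n)) (f : Euc n → ℝ≥0∞) (x : Euc n) : ℝ≥0∞ :=
  ⨆ j : ℤ, (σ (Bl x j))⁻¹ * ∫⁻ z in Bl x j, f z ∂σ

lemma _root_.measurable_Mx [SFinite σ] {f : Euc n → ℝ≥0∞} (hf : Measurable f) :
    Measurable (Mx σ f) := by
  refine Measurable.iSup fun j => ?_
  exact (measurable_Bl σ j).inv.mul (measurable_setLIntegral_Bl σ j (f := fun _ z => f z)
    (hf.comp measurable_snd))

lemma weak_aux (h : Dbl σ D) (f : Euc n → ℝ≥0∞) (t : ℝ≥0∞) (J : ℤ) :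
    t * σ {x | ∃ j ≤ J, t * σ (Bl x j) ≤ ∫⁻ z in Bl x j, f z ∂σ} ≤ D ^ 3 * ∫⁻ z, f z ∂σ := by
  set A := {x | ∃ j ≤ J, t * σ (Bl x j) ≤ ∫⁻ z in Bl x j, f z ∂σ} with hA
  have hex : ∀ x : Euc n, ∃ j : ℤ, x ∈ A → (j ≤ J ∧ t * σ (Bl x j) ≤ ∫⁻ z in Bl x j, f z ∂σ) := by
    intro x
    by_cases hx : x ∈ A
    · obtain ⟨j, hj⟩ := hx
      exact ⟨j, fun _ => hj⟩
    · exact ⟨0, fun h => absurd h hx⟩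
  choose j hj using hex
  obtain ⟨u, hu, hdisj, hcov⟩ := Vitali.exists_disjoint_subfamily_covering_enlargement_closedBall
    A (fun x => x) (fun x => (2:ℝ)^(j x)) ((2:ℝ)^J) (fun x hx => two_zpow_mono (hj x hx).1) 5
    (by norm_num)
  have hdisj' : u.PairwiseDisjoint fun x => Bl x (j x) :=
    hdisj.mono fun x => ball_subset_closedBall
  have hcount : u.Countable := hdisj'.countable_of_isOpen (fun _ _ => isOpen_ball)
    (fun x _ => ⟨x, self_mem_Bl x _⟩)
  have hAsub : A ⊆ ⋃ x ∈ u, Bl x (j x + (3:ℕ)) := by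
    intro x hx
    obtain ⟨b, hb, hsub⟩ := hcov x hx
    have hmem := hsub (mem_closedBall_self (two_zpow_pos _).le)
    refine mem_biUnion hb ?_
    rw [mem_Bl]
    rw [mem_closedBall] at hmem
    have : (2:ℝ)^(j b + (3:ℕ)) = 8 * (2:ℝ)^(j b) := by
      rw [zpow_add₀ (by norm_num)]; norm_num; ring
    rw [this]
    linarith [two_zpow_pos (j b)]
  have := hcount.to_subtype
  calc t * σ A ≤ t * ∑' x : u, σ (Bl (x : Euc n) (j x + (3:ℕ))) := by
        gcongr
        exact (measure_mono hAsub).trans (measure_biUnion_le _ hcount _)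
    _ ≤ t * ∑' x : u, D ^ 3 * σ (Bl (x : Euc n) (j x)) := by
        gcongr with x
        exact h.shift _ _ 3
    _ = D ^ 3 * ∑' x : u, t * σ (Bl (x : Euc n) (j x)) := by
        rw [ENNReal.tsum_mul_left, ENNReal.tsum_mul_left]; ring
    _ ≤ D ^ 3 * ∑' x : u, ∫⁻ z in Bl (x : Euc n) (j x), f z ∂σ := by
        gcongr with x
        exact (hj x (hu x.2)).2
    _ = D ^ 3 * ∫⁻ z in ⋃ x ∈ u, Bl x (j x), f z ∂σ := by
        rw [lintegral_biUnion hcount (fun _ _ => measurableSet_Bl _ _) hdisj']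
    _ ≤ _ := by
        gcongr
        exact Measure.restrict_le_self

lemma weak (h : Dbl σ D) (f : Euc n → ℝ≥0∞) (t : ℝ≥0∞) :
    t * σ {x | t < Mx σ f x} ≤ D ^ 3 * ∫⁻ z, f z ∂σ := by
  set A : ℕ → Set (Euc n) := fun J =>
    {x | ∃ j ≤ (J:ℤ), t * σ (Bl x j) ≤ ∫⁻ z in Bl x j, f z ∂σ}
  have hsub : {x | t < Mx σ f x} ⊆ ⋃ J, A J := by
    intro x hx
    have hx : t < Mx σ f x := hx
    rw [Mx, lt_iSup_iff] at hx
    obtain ⟨j, hj⟩ := hx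
    refine mem_iUnion.2 ⟨j.toNat, j, Int.self_le_toNat j, ?_⟩
    rw [← ENNReal.div_eq_inv_mul] at hj
    exact ENNReal.mul_le_of_le_div hj.le
  have hmono : Monotone A := by
    intro J J' hJ x hx
    obtain ⟨j, hj, hx⟩ := hx
    exact ⟨j, hj.trans (by exact_mod_cast hJ), hx⟩
  calc t * σ {x | t < Mx σ f x} ≤ t * σ (⋃ J, A J) := by gcongr
    _ = ⨆ J, t * σ (A J) := by rw [hmono.measure_iUnion, ENNReal.mul_iSup]
    _ ≤ _ := iSup_le fun J => h.weak_aux f t J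

lemma weak2 (h : Dbl σ D) {f : Euc n → ℝ≥0∞} (hf : Measurable f) (t : ℝ≥0∞) :
    t * σ {x | 2 * t < Mx σ f x} ≤ D ^ 3 * ∫⁻ z, (if t < f z then f z else 0) ∂σ := by
  refine le_trans ?_ (h.weak (fun z => if t < f z then f z else 0) t)
  gcongr t * σ ?_
  intro x hx
  have hx : 2 * t < Mx σ f x := hx
  change t < Mx σ _ x
  rw [Mx, lt_iSup_iff] at hx ⊢
  obtain ⟨j, hj⟩ := hx
  refine ⟨j, ?_⟩
  by_contra! hcon
  refine absurd hj (not_lt.2 ?_)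
  have hm : Measurable fun z => if t < f z then f z else 0 :=
    Measurable.ite (measurableSet_lt measurable_const hf) hf measurable_const
  calc (σ (Bl x j))⁻¹ * ∫⁻ z in Bl x j, f z ∂σ
      ≤ (σ (Bl x j))⁻¹ * ∫⁻ z in Bl x j, ((if t < f z then f z else 0) + t) ∂σ := by
        gcongr with z
        split_ifs with hz
        · exact le_self_add
        · simpa using hz
    _ = (σ (Bl x j))⁻¹ * ∫⁻ z in Bl x j, (if t < f z then f z else 0) ∂σ + t := by
        rw [lintegral_add_left hm, mul_add]
        congr 1
        rw [setLIntegral_const, mul_comm t, ← mul_assoc,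
          ENNReal.inv_mul_cancel (h.pos _ _) (h.fin _ _), one_mul]
    _ ≤ 2 * t := by rw [two_mul]; gcongr

lemma strong (h : Dbl σ D) [SFinite σ] {q : ℝ} (hq : 1 < q) :
    ∃ C : ℝ≥0∞, C ≠ ∞ ∧ ∀ f : Euc n → ℝ≥0∞, Measurable f →
      ∫⁻ x, Mx σ f x ^ q ∂σ ≤ C * ∫⁻ x, f x ^ q ∂σ := by
  refine ⟨ENNReal.ofReal q * (2 * (D ^ 3 * ((ENNReal.ofReal (q-1))⁻¹ * 2 ^ (q-1)))), ?_, ?_⟩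
  · have : ENNReal.ofReal (q - 1) ≠ 0 := by simp; linarith
    have h2 : (2:ℝ≥0∞) ^ (q - 1) ≠ ∞ := ENNReal.rpow_ne_top_of_nonneg (by linarith) (by simp)
    have := h.ne_top
    finiteness
  intro f hf
  have hMm := measurable_Mx (σ := σ) hf
  have hq0 : 0 < q := by linarith
  have hcm : Measurable fun t : ℝ => ENNReal.ofReal (t ^ (q - 1)) := by fun_prop
  have hcm2 : Measurable fun t : ℝ => ENNReal.ofReal (t ^ (q - 1 - 1)) := by fun_prop
  calc ∫⁻ x, Mx σ f x ^ q ∂σ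
      = ∫⁻ x, ENNReal.ofReal q * (∫⁻ t in Ioi (0:ℝ),
          (if ENNReal.ofReal t < Mx σ f x then 1 else 0) * ENNReal.ofReal (t ^ (q - 1))) ∂σ := by
        simp_rw [← layer_number _ hq0]
    _ = ENNReal.ofReal q * ∫⁻ x, (∫⁻ t in Ioi (0:ℝ),
          (if ENNReal.ofReal t < Mx σ f x then 1 else 0) * ENNReal.ofReal (t ^ (q - 1))) ∂σ := by
        rw [lintegral_const_mul' _ _ (by simp)]
    _ = ENNReal.ofReal q * ∫⁻ t in Ioi (0:ℝ), ∫⁻ x,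
          (if ENNReal.ofReal t < Mx σ f x then 1 else 0) * ENNReal.ofReal (t ^ (q - 1)) ∂σ := by
        rw [lintegral_lintegral_swap]
        refine Measurable.aemeasurable ?_
        refine Measurable.mul (Measurable.ite (measurableSet_lt ?_ ?_) measurable_const
          measurable_const) (hcm.comp measurable_snd)
        · exact ENNReal.measurable_ofReal.comp measurable_snd
        · exact hMm.comp measurable_fst
    _ ≤ ENNReal.ofReal q * ∫⁻ t in Ioi (0:ℝ), 2 * (D ^ 3 * ∫⁻ x,
          (f x * ((if ENNReal.ofReal t < 2 * f x then 1 else 0) * ENNReal.ofReal (t ^ (q - 1 - 1)))) ∂σ) := by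
        refine mul_le_mul' le_rfl ?_
        refine setLIntegral_mono' measurableSet_Ioi fun t ht => ?_
        have ht : 0 < t := ht
        have hm : MeasurableSet {x | ENNReal.ofReal t < Mx σ f x} :=
          measurableSet_lt measurable_const hMm
        have e1 : ∫⁻ x, (if ENNReal.ofReal t < Mx σ f x then 1 else 0) *
            ENNReal.ofReal (t ^ (q - 1)) ∂σ =
            ENNReal.ofReal (t ^ (q - 1)) * σ {x | ENNReal.ofReal t < Mx σ f x} := by
          rw [lintegral_mul_const' _ _ (by simp), mul_comm]
          congr 1
          rw [← lintegral_indicator_one hm]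
          refine lintegral_congr fun x => ?_
          simp [indicator]
        have e2 : ENNReal.ofReal (t ^ (q - 1)) =
            2 * (ENNReal.ofReal (t ^ (q - 1 - 1)) * ENNReal.ofReal (t / 2)) := by
          have : t ^ (q - 1) = 2 * (t ^ (q - 1 - 1) * (t / 2)) := by
            rw [Real.rpow_sub_one ht.ne' (q - 1)]; field_simp
          rw [this, ENNReal.ofReal_mul (by norm_num), ENNReal.ofReal_mul (by positivity)]
          simp
        have e3 : ENNReal.ofReal t = 2 * ENNReal.ofReal (t / 2) := by
          rw [← ENNReal.ofReal_ofNat, ← ENNReal.ofReal_mul (by norm_num)]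
          congr 1; ring
        rw [e1, e2, mul_assoc, mul_assoc]
        gcongr 2 * ?_
        have := h.weak2 hf (ENNReal.ofReal (t/2))
        rw [← e3] at this
        calc _ ≤ ENNReal.ofReal (t ^ (q - 1 - 1)) *
            (D ^ 3 * ∫⁻ z, (if ENNReal.ofReal (t/2) < f z then f z else 0) ∂σ) := by gcongr
          _ = D ^ 3 * ∫⁻ z, ENNReal.ofReal (t ^ (q - 1 - 1)) *
              (if ENNReal.ofReal (t/2) < f z then f z else 0) ∂σ := by
              rw [lintegral_const_mul' _ _ (by simp)]; ring
          _ ≤ _ := by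
              refine mul_le_mul' le_rfl (lintegral_mono fun z => ?_)
              rw [e3]
              by_cases hz : ENNReal.ofReal (t/2) < f z
              · have : 2 * ENNReal.ofReal (t/2) < 2 * f z :=
                  (ENNReal.mul_lt_mul_iff_right (by simp) (by simp)).2 hz
                simp only [hz, this, if_true]
                rw [one_mul, mul_comm]
              · simp [hz]
    _ = ENNReal.ofReal q * (2 * (D ^ 3 * ∫⁻ t in Ioi (0:ℝ), ∫⁻ x,
          (f x * ((if ENNReal.ofReal t < 2 * f x then 1 else 0) * ENNReal.ofReal (t ^ (q - 1 - 1)))) ∂σ)) := by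
        rw [lintegral_const_mul' _ _ (by simp), lintegral_const_mul' _ _ (by have := h.ne_top; finiteness)]
    _ = ENNReal.ofReal q * (2 * (D ^ 3 * ∫⁻ x, (∫⁻ t in Ioi (0:ℝ),
          (f x * ((if ENNReal.ofReal t < 2 * f x then 1 else 0) * ENNReal.ofReal (t ^ (q - 1 - 1))))) ∂σ)) := by
        rw [lintegral_lintegral_swap]
        refine Measurable.aemeasurable ?_
        refine (hf.comp measurable_snd).mul (Measurable.mul (Measurable.ite (measurableSet_lt ?_ ?_) measurable_const
          measurable_const) (hcm2.comp measurable_fst))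
        · exact ENNReal.measurable_ofReal.comp measurable_fst
        · exact (hf.comp measurable_snd).const_mul 2
    _ = ENNReal.ofReal q * (2 * (D ^ 3 * ∫⁻ x, ((ENNReal.ofReal (q-1))⁻¹ * 2 ^ (q-1)) * f x ^ q ∂σ)) := by
        congr 4
        ext x
        have hl := layer_number (2 * f x) (show 0 < q - 1 by linarith)
        have hm : Measurable fun t : ℝ => ((if ENNReal.ofReal t < 2 * f x then (1:ℝ≥0∞) else 0) * ENNReal.ofReal (t ^ (q - 1 - 1))) :=
          (Measurable.ite (measurableSet_lt ENNReal.measurable_ofReal measurable_const) measurable_const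
            measurable_const).mul hcm2
        have hne : ENNReal.ofReal (q - 1) ≠ 0 := by simp; linarith
        rw [lintegral_const_mul _ hm]
        have : ∫⁻ t in Ioi (0:ℝ), (if ENNReal.ofReal t < 2 * f x then (1:ℝ≥0∞) else 0) *
            ENNReal.ofReal (t ^ (q - 1 - 1)) = (ENNReal.ofReal (q-1))⁻¹ * (2 * f x) ^ (q - 1) := by
          rw [hl, ← mul_assoc, ENNReal.inv_mul_cancel hne (by simp), one_mul]
        rw [this, ENNReal.mul_rpow_of_nonneg _ _ (by linarith)]
        have e : f x ^ q = f x * f x ^ (q - 1) := by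
          conv_rhs => enter [1]; rw [← ENNReal.rpow_one (f x)]
          rw [← ENNReal.rpow_add_of_nonneg _ _ (by linarith) (by linarith)]
          congr 1; ring
        rw [e]; ring
    _ = _ := by
        rw [lintegral_const_mul _ (hf.pow_const q)]; ring

end Dbl

/-! ### The abstract dyadic setting -/

structure Hyp {n : ℕ} (σ : Measure (Euc n)) (b : ℤ → ℝ≥0∞) (K : ℤ → Euc n → ℝ≥0∞) (D : ℝ≥0∞) : Prop
    extends Dbl σ D where
  b_fin : ∀ j, b j ≠ ∞
  Kmeas : ∀ j, Measurable (K j)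
  Kup : ∀ j x, K (j+1) x ≤ D * K j x
  Kdown : ∀ j x, K j x ≤ D * K (j+1) x
  lbo : ∀ j x z, x ∈ Bl z j → K j x ≤ D * K j z
  sumK : ∀ x j (s : Finset ℤ), (∀ i ∈ s, i ≤ j) →
    ∑ i ∈ s, b i * σ (Bl x i) ≤ D * (K j x * σ (Bl x j))

namespace Dbl

variable {n : ℕ} {σ : Measure (Euc n)} {D : ℝ≥0∞}

lemma av (h : Dbl σ D) [SFinite σ] (j : ℤ) {H1 H2 f : Euc n → ℝ≥0∞} (hH : Measurable H2)
    (hf : Measurable f) (hle : ∀ x z, z ∈ Bl x j → H1 x ≤ H2 z) :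
    ∫⁻ x, H1 x * f x ∂σ ≤ D * ∫⁻ z, H2 z * ((σ (Bl z j))⁻¹ * ∫⁻ x in Bl z j, f x ∂σ) ∂σ := by
  have hV := (measurable_Bl σ j).inv
  have hm : Measurable (Function.uncurry fun x z : Euc n => H2 z * (σ (Bl z j))⁻¹ * f x) := by
    have h1 : Measurable fun w : Euc n × Euc n => (σ (Bl w.2 j))⁻¹ := hV.comp measurable_snd
    exact ((hH.comp measurable_snd).mul h1).mul (hf.comp measurable_fst)
  calc ∫⁻ x, H1 x * f x ∂σ ≤
      ∫⁻ x, D * ∫⁻ z in Bl x j, H2 z * (σ (Bl z j))⁻¹ * f x ∂σ ∂σ := by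
        refine lintegral_mono fun x => ?_
        have h1 : H1 x * f x = ∫⁻ z in Bl x j, H1 x * f x * (σ (Bl x j))⁻¹ ∂σ := by
          rw [setLIntegral_const, mul_assoc, ENNReal.inv_mul_cancel (h.pos _ _) (h.fin _ _), mul_one]
        rw [← lintegral_const_mul' _ _ h.ne_top]
        calc H1 x * f x = ∫⁻ z in Bl x j, H1 x * f x * (σ (Bl x j))⁻¹ ∂σ := h1
          _ ≤ _ := by
            refine setLIntegral_mono' (measurableSet_Bl _ _) fun z hz => ?_
            have := h.inv_comp (x := x) (z := z) (j := j) 0 (by simpa using mem_Bl_comm.1 hz)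
            simp only [zero_add, pow_one] at this
            calc H1 x * f x * (σ (Bl x j))⁻¹ ≤ H2 z * f x * (D * (σ (Bl z j))⁻¹) := by
                  gcongr
                  exact hle x z hz
              _ = _ := by ring
    _ = D * ∫⁻ x, ∫⁻ z in Bl x j, H2 z * (σ (Bl z j))⁻¹ * f x ∂σ ∂σ := by
        rw [lintegral_const_mul' _ _ h.ne_top]
    _ = D * ∫⁻ z, ∫⁻ x in Bl z j, H2 z * (σ (Bl z j))⁻¹ * f x ∂σ ∂σ := by
        rw [swap_Bl _ _ _ hm]
    _ = _ := by
        congr 1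
        refine lintegral_congr fun z => ?_
        rw [lintegral_const_mul _ hf, mul_assoc]

lemma grow (h : Dbl σ D) [SFinite σ] (μ : Measure (Euc n)) [SFinite μ] (x : Euc n) (j : ℤ) (a : ℕ) :
    μ (Bl x (j + a)) ≤ D ^ (a+1) * ((σ (Bl x j))⁻¹ * ∫⁻ z in Bl x (j+a+1), μ (Bl z j) ∂σ) := by
  have key : σ (Bl x j) * μ (Bl x (j+a)) ≤ D ^ (a+1) * ∫⁻ z in Bl x (j+a+1), μ (Bl z j) ∂σ := by
    calc σ (Bl x j) * μ (Bl x (j+a)) = ∫⁻ w in Bl x (j+a), σ (Bl x j) ∂μ := by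
          rw [setLIntegral_const]
      _ ≤ ∫⁻ w in Bl x (j+a), D ^ (a+1) * (∫⁻ z in Bl w j, 1 ∂(σ.restrict (Bl x (j+a+1)))) ∂μ := by
          refine setLIntegral_mono' (measurableSet_Bl _ _) fun w hw => ?_
          have e : (∫⁻ z in Bl w j, 1 ∂(σ.restrict (Bl x (j+a+1)))) = σ (Bl w j) := by
            rw [setLIntegral_one, Measure.restrict_apply (measurableSet_Bl _ _),
              inter_eq_self_of_subset_left]
            apply Bl_subset hw <;> omega
          rw [e]
          exact h.comp a (mem_Bl_comm.1 hw)
      _ = D ^ (a+1) * ∫⁻ w in Bl x (j+a), (∫⁻ z in Bl w j, 1 ∂(σ.restrict (Bl x (j+a+1)))) ∂μ := by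
          rw [lintegral_const_mul' _ _ (by have := h.ne_top; finiteness)]
      _ = D ^ (a+1) * ∫⁻ z in Bl x (j+a+1), (∫⁻ w in Bl z j, 1 ∂(μ.restrict (Bl x (j+a)))) ∂σ := by
          rw [swap_Bl _ _ _ (f := fun _ _ => 1) measurable_const]
      _ ≤ _ := by
          gcongr with z
          rw [setLIntegral_one]
          exact Measure.restrict_apply_le _ _
  calc μ (Bl x (j + a)) = (σ (Bl x j))⁻¹ * (σ (Bl x j) * μ (Bl x (j+a))) := by
        rw [← mul_assoc, ENNReal.inv_mul_cancel (h.pos _ _) (h.fin _ _), one_mul]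
    _ ≤ (σ (Bl x j))⁻¹ * (D ^ (a+1) * ∫⁻ z in Bl x (j+a+1), μ (Bl z j) ∂σ) := by gcongr
    _ = _ := by ring

lemma dualD (h : Dbl σ D) [SFinite σ] (μ : Measure (Euc n)) [SFinite μ] (j : ℤ) (a : ℕ)
    {g : Euc n → ℝ≥0∞} (hg : Measurable g) :
    ∫⁻ x, μ (Bl x (j+a)) * g x ∂σ ≤ D ^ (3 * a + 4) * ∫⁻ z, μ (Bl z j) * Mx σ g z ∂σ := by
  have hV := (measurable_Bl σ j).inv
  have hμ := measurable_Bl μ j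
  have hm : Measurable (Function.uncurry fun x z : Euc n => g x * (σ (Bl x j))⁻¹ * μ (Bl z j)) := by
    have h1 : Measurable fun w : Euc n × Euc n => (σ (Bl w.1 j))⁻¹ := hV.comp measurable_fst
    have h2 : Measurable fun w : Euc n × Euc n => μ (Bl w.2 j) := hμ.comp measurable_snd
    exact ((hg.comp measurable_fst).mul h1).mul h2
  have hD : ∀ m : ℕ, D ^ m ≠ ∞ := fun m => by have := h.ne_top; finiteness
  calc ∫⁻ x, μ (Bl x (j+a)) * g x ∂σ
      ≤ ∫⁻ x, D ^ (a+1) * ∫⁻ z in Bl x (j+a+1), g x * (σ (Bl x j))⁻¹ * μ (Bl z j) ∂σ ∂σ := by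
        refine lintegral_mono fun x => ?_
        dsimp only
        rw [lintegral_const_mul _ hμ]
        calc μ (Bl x (j+a)) * g x ≤ D ^ (a+1) * ((σ (Bl x j))⁻¹ *
              ∫⁻ z in Bl x (j+a+1), μ (Bl z j) ∂σ) * g x := by
              gcongr
              exact h.grow μ x j a
          _ = _ := by ring
    _ = D ^ (a+1) * ∫⁻ z, ∫⁻ x in Bl z (j+a+1), g x * (σ (Bl x j))⁻¹ * μ (Bl z j) ∂σ ∂σ := by
        rw [lintegral_const_mul' _ _ (hD _), swap_Bl _ _ _ hm]
    _ ≤ D ^ (a+1) * ∫⁻ z, D ^ (2*a+3) * (μ (Bl z j) * Mx σ g z) ∂σ := by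
        refine mul_le_mul' le_rfl (lintegral_mono fun z => ?_)
        have e : (σ (Bl z j))⁻¹ ≤ D ^ (a+1) * (σ (Bl z (j+a+1)))⁻¹ := by
          have := h.shift z j (a+1)
          push_cast at this
          rw [← add_assoc] at this
          rw [ENNReal.inv_le_iff_inv_le, ENNReal.mul_inv (Or.inr (by simp [h.pos]))
            (Or.inr (by simp [h.fin])), inv_inv, ← ENNReal.div_eq_inv_mul]
          exact ENNReal.div_le_of_le_mul' this
        calc ∫⁻ x in Bl z (j+a+1), g x * (σ (Bl x j))⁻¹ * μ (Bl z j) ∂σ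
            ≤ ∫⁻ x in Bl z (j+a+1), (D ^ (2*a+3) * (σ (Bl z (j+a+1)))⁻¹ * μ (Bl z j)) * g x ∂σ := by
              refine setLIntegral_mono' (measurableSet_Bl _ _) fun x hx => ?_
              have := h.inv_comp (x := x) (z := z) (j := j) (a+1) (by
                push_cast; rwa [← add_assoc])
              calc g x * (σ (Bl x j))⁻¹ * μ (Bl z j)
                  ≤ g x * (D ^ (a+1+1) * (D ^ (a+1) * (σ (Bl z (j+a+1)))⁻¹)) * μ (Bl z j) := by
                    gcongr
                    exact this.trans (by gcongr)
                _ = _ := by ring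
          _ = D ^ (2*a+3) * (μ (Bl z j) * ((σ (Bl z (j+a+1)))⁻¹ * ∫⁻ x in Bl z (j+a+1), g x ∂σ)) := by
              rw [lintegral_const_mul _ hg]; ring
          _ ≤ _ := by
              gcongr
              exact le_iSup (fun l => (σ (Bl z l))⁻¹ * ∫⁻ x in Bl z l, g x ∂σ) (j+a+1)
    _ = _ := by
        rw [lintegral_const_mul' _ _ (hD _)]; ring

end Dbl

lemma rpow_split (x : ℝ≥0∞) {q : ℝ} (hq : 1 ≤ q) : x ^ q = x * x ^ (q - 1) := by
  conv_rhs => enter [1]; rw [← ENNReal.rpow_one x]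
  rw [← ENNReal.rpow_add_of_nonneg _ _ (by linarith) (by linarith)]
  congr 1; ring

/-- absorption -/
lemma absorb {X Y C : ℝ≥0∞} {α : ℝ} (h0 : 0 < α) (h1 : α ≤ 1) (hX : X ≠ ∞)
    (h : X ≤ C * (Y ^ α * X ^ (1 - α))) : X ≤ C ^ (1/α) * Y := by
  by_cases hX0 : X = 0
  · simp [hX0]
  have hne : X ^ (1 - α) ≠ 0 := by
    rw [Ne, ENNReal.rpow_eq_zero_iff]; push Not
    exact ⟨fun h => absurd h hX0, fun h => absurd h hX⟩
  have hnt : X ^ (1 - α) ≠ ∞ := ENNReal.rpow_ne_top_of_nonneg (by linarith) hX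
  have h2 : X ^ α ≤ C * Y ^ α := by
    have e : X = X ^ α * X ^ (1 - α) := by
      rw [← ENNReal.rpow_add_of_nonneg _ _ h0.le (by linarith)]
      simp
    rw [← mul_assoc] at h
    nth_rewrite 1 [e] at h
    exact (ENNReal.mul_le_mul_iff_left hne hnt).1 h
  calc X = (X ^ α) ^ (1/α) := by rw [← ENNReal.rpow_mul, mul_one_div_cancel h0.ne', ENNReal.rpow_one]
    _ ≤ (C * Y ^ α) ^ (1/α) := by gcongr
    _ = _ := by
      rw [ENNReal.mul_rpow_of_nonneg _ _ (by positivity), ← ENNReal.rpow_mul, mul_one_div_cancel h0.ne',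
        ENNReal.rpow_one]

/-- Holder for finite sums of integrals -/
lemma holder_sum {α : Type*} [MeasurableSpace α] (σ : Measure α) (s : Finset ℤ)
    {F G : ℤ → α → ℝ≥0∞} (hF : ∀ j, Measurable (F j)) (hG : ∀ j, Measurable (G j)) {r : ℝ}
    (h0 : 0 ≤ r) (h1 : r ≤ 1) :
    ∑ j ∈ s, ∫⁻ x, F j x ^ r * G j x ^ (1 - r) ∂σ ≤
      (∑ j ∈ s, ∫⁻ x, F j x ∂σ) ^ r * (∑ j ∈ s, ∫⁻ x, G j x ∂σ) ^ (1 - r) := by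
  have hs := lintegral_mul_norm_pow_le (μ := ∑ j ∈ s, Measure.dirac j)
    (f := fun j => ∫⁻ x, F j x ∂σ) (g := fun j => ∫⁻ x, G j x ∂σ) (p := r) (q := 1 - r)
    (measurable_of_countable _).aemeasurable (measurable_of_countable _).aemeasurable
    h0 (by linarith) (by ring)
  simp only [lintegral_finsetSum_measure, lintegral_dirac] at hs
  refine le_trans (Finset.sum_le_sum fun j _ => ?_) hs
  exact lintegral_mul_norm_pow_le (hF j).aemeasurable (hG j).aemeasurable h0 (by linarith) (by ring)

/-! ### The abstract lower bound -/

namespace Dbl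

variable {n : ℕ} {σ : Measure (Euc n)} {D : ℝ≥0∞}

lemma grow_rpow (h : Dbl σ D) [SFinite σ] (μ : Measure (Euc n)) [SFinite μ] (x : Euc n) (j : ℤ)
    (a : ℕ) {q : ℝ} (hq : 1 < q) :
    μ (Bl x (j + a)) ^ q ≤ ((D ^ (a+1)) ^ q * (D ^ (a+1)) ^ (q-1)) *
      ((σ (Bl x j))⁻¹ * ∫⁻ z in Bl x (j+a+1), μ (Bl z j) ^ q ∂σ) := by
  set E := D ^ (a+1)
  set V := σ (Bl x j)
  set I := ∫⁻ z in Bl x (j+a+1), μ (Bl z j) ^ q ∂σ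
  have hsh : σ (Bl x (j+a+1)) ≤ E * V := by
    have := h.shift x j (a+1)
    push_cast at this
    rwa [← add_assoc] at this
  have hJ : (∫⁻ z in Bl x (j+a+1), μ (Bl z j) ∂σ) ^ q ≤ (E * V) ^ (q-1) * I := by
    have := jensen_convex (σ.restrict (Bl x (j+a+1))) (measurable_Bl μ j).aemeasurable hq
    rw [Measure.restrict_apply_univ] at this
    refine this.trans ?_
    refine mul_le_mul' ?_ le_rfl
    exact ENNReal.rpow_le_rpow hsh (by linarith)
  have hVV : V⁻¹ ^ q * V ^ (q-1) = V⁻¹ := by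
    rw [rpow_split _ hq.le, mul_assoc, ← ENNReal.mul_rpow_of_nonneg _ _ (by linarith),
      ENNReal.inv_mul_cancel (h.pos _ _) (h.fin _ _), ENNReal.one_rpow, mul_one]
  calc μ (Bl x (j + a)) ^ q ≤ (E * (V⁻¹ * ∫⁻ z in Bl x (j+a+1), μ (Bl z j) ∂σ)) ^ q :=
        ENNReal.rpow_le_rpow (h.grow μ x j a) (by linarith)
    _ = E ^ q * (V⁻¹ ^ q * (∫⁻ z in Bl x (j+a+1), μ (Bl z j) ∂σ) ^ q) := by
        rw [ENNReal.mul_rpow_of_nonneg _ _ (by linarith), ENNReal.mul_rpow_of_nonneg _ _ (by linarith)]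
    _ ≤ E ^ q * (V⁻¹ ^ q * ((E * V) ^ (q-1) * I)) := by
        gcongr
    _ = E ^ q * E ^ (q-1) * ((V⁻¹ ^ q * V ^ (q-1)) * I) := by
        rw [ENNReal.mul_rpow_of_nonneg _ _ (by linarith)]; ring
    _ = _ := by rw [hVV]

end Dbl

namespace Hyp

variable {n : ℕ} {σ : Measure (Euc n)} {b : ℤ → ℝ≥0∞} {K : ℤ → Euc n → ℝ≥0∞} {D : ℝ≥0∞}

lemma K_down (H : Hyp σ b K D) (j : ℤ) (a : ℕ) (x : Euc n) : K j x ≤ D ^ a * K (j+a) x := by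
  induction a with
  | zero => simp
  | succ a ih =>
    refine ih.trans ?_
    push_cast
    rw [← add_assoc, pow_succ, mul_assoc]
    gcongr
    exact H.Kdown _ _

lemma K_up (H : Hyp σ b K D) (j : ℤ) (a : ℕ) (x : Euc n) : K (j+a) x ≤ D ^ a * K j x := by
  induction a with
  | zero => simp
  | succ a ih =>
    push_cast
    rw [← add_assoc, pow_succ', mul_assoc]
    refine (H.Kup _ _).trans ?_
    gcongr

lemma K_comp (H : Hyp σ b K D) {j : ℤ} (a : ℕ) {x z : Euc n} (hx : x ∈ Bl z (j+a)) :
    K j x ≤ D ^ (2*a+1) * K j z := by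
  calc K j x ≤ D ^ a * K (j+a) x := H.K_down j a x
    _ ≤ D ^ a * (D * (D ^ a * K j z)) := by
      gcongr
      exact (H.lbo _ _ _ hx).trans (by gcongr; exact H.K_up j a z)
    _ = _ := by ring

lemma phi (H : Hyp σ b K D) [SFinite σ] (a : ℕ) {q : ℝ} (hq : 1 < q) :
    ∃ C : ℝ≥0∞, C ≠ ∞ ∧ ∀ (μ : Measure (Euc n)) [SFinite μ] (l : ℤ),
      ∫⁻ x, K l x ^ (q-1) * μ (Bl x (l+a)) ^ q ∂σ ≤
        C * ∫⁻ y, σ (Bl y l) * (K l y * μ (Bl y (l+1))) ^ (q-1) ∂μ := by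
  have hDt := H.ne_top
  have hq1 : 0 ≤ q - 1 := by linarith
  set C1 : ℝ≥0∞ := (D ^ (a+1)) ^ q * (D ^ (a+1)) ^ (q-1) with hC1
  set C2 : ℝ≥0∞ := (D ^ (2*(a+1)+1)) ^ (q-1) * D ^ (a+1+1) * D ^ (a+1) with hC2
  have hC1t : C1 ≠ ∞ := by
    have h0 : D ^ (a+1) ≠ ∞ := by finiteness
    exact ENNReal.mul_ne_top (ENNReal.rpow_ne_top_of_nonneg (by linarith) h0)
      (ENNReal.rpow_ne_top_of_nonneg hq1 h0)
  have hC2t : C2 ≠ ∞ := by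
    have h0 : D ^ (2*(a+1)+1) ≠ ∞ := by finiteness
    have h1 := ENNReal.rpow_ne_top_of_nonneg hq1 h0
    finiteness
  have hDq : D ^ (q-1) ≠ ∞ := ENNReal.rpow_ne_top_of_nonneg hq1 hDt
  refine ⟨C1 * (C2 * D ^ (q-1)), by finiteness, fun μ _ l => ?_⟩
  have hV := (measurable_Bl σ l).inv
  have hμ := measurable_Bl μ l
  have hK := H.Kmeas l
  have hm : Measurable (Function.uncurry fun x z : Euc n =>
      K l x ^ (q-1) * (σ (Bl x l))⁻¹ * μ (Bl z l) ^ q) := by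
    have h1 : Measurable fun w : Euc n × Euc n => (σ (Bl w.1 l))⁻¹ := hV.comp measurable_fst
    have h2 : Measurable fun w : Euc n × Euc n => μ (Bl w.2 l) := hμ.comp measurable_snd
    exact (((hK.comp measurable_fst).pow_const _).mul h1).mul (h2.pow_const _)
  have hm2 : Measurable (Function.uncurry fun z _ : Euc n =>
      K l z ^ (q-1) * μ (Bl z l) ^ (q-1)) := by
    have h2 : Measurable fun w : Euc n × Euc n => μ (Bl w.1 l) := hμ.comp measurable_fst
    exact ((hK.comp measurable_fst).pow_const _).mul (h2.pow_const _)
  calc ∫⁻ x, K l x ^ (q-1) * μ (Bl x (l+a)) ^ q ∂σ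
      ≤ ∫⁻ x, C1 * ∫⁻ z in Bl x (l+a+1), K l x ^ (q-1) * (σ (Bl x l))⁻¹ * μ (Bl z l) ^ q ∂σ ∂σ := by
        refine lintegral_mono fun x => ?_
        dsimp only
        rw [lintegral_const_mul _ (hμ.pow_const _)]
        calc _ ≤ K l x ^ (q-1) * (C1 * ((σ (Bl x l))⁻¹ * ∫⁻ z in Bl x (l+a+1), μ (Bl z l) ^ q ∂σ)) :=
              mul_le_mul' le_rfl (H.toDbl.grow_rpow μ x l a hq)
          _ = _ := by ring
    _ = C1 * ∫⁻ z, ∫⁻ x in Bl z (l+a+1), K l x ^ (q-1) * (σ (Bl x l))⁻¹ * μ (Bl z l) ^ q ∂σ ∂σ := by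
        rw [lintegral_const_mul' _ _ hC1t, swap_Bl _ _ _ hm]
    _ ≤ C1 * ∫⁻ z, C2 * ∫⁻ y in Bl z l, K l z ^ (q-1) * μ (Bl z l) ^ (q-1) ∂μ ∂σ := by
        refine mul_le_mul' le_rfl (lintegral_mono fun z => ?_)
        have hsh : σ (Bl z (l+a+1)) ≤ D ^ (a+1) * σ (Bl z l) := by
          have := H.toDbl.shift z l (a+1)
          push_cast at this
          rwa [← add_assoc] at this
        calc ∫⁻ x in Bl z (l+a+1), K l x ^ (q-1) * (σ (Bl x l))⁻¹ * μ (Bl z l) ^ q ∂σ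
            ≤ ∫⁻ x in Bl z (l+a+1), (D ^ (2*(a+1)+1) * K l z) ^ (q-1) *
                (D ^ (a+1+1) * (σ (Bl z l))⁻¹) * μ (Bl z l) ^ q ∂σ := by
              refine setLIntegral_mono' (measurableSet_Bl _ _) fun x hx => ?_
              have hx' : x ∈ Bl z (l + ((a+1 : ℕ) : ℤ)) := by push_cast; rwa [← add_assoc]
              refine mul_le_mul' (mul_le_mul' ?_ ?_) le_rfl
              · exact ENNReal.rpow_le_rpow (H.K_comp (a+1) hx') hq1
              · exact H.toDbl.inv_comp (a+1) hx'
          _ = (D ^ (2*(a+1)+1) * K l z) ^ (q-1) *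
                (D ^ (a+1+1) * (σ (Bl z l))⁻¹) * μ (Bl z l) ^ q * σ (Bl z (l+a+1)) := by
              rw [setLIntegral_const]
          _ ≤ (D ^ (2*(a+1)+1) * K l z) ^ (q-1) *
                (D ^ (a+1+1) * (σ (Bl z l))⁻¹) * μ (Bl z l) ^ q * (D ^ (a+1) * σ (Bl z l)) := by
              refine mul_le_mul' le_rfl hsh
          _ = C2 * (K l z ^ (q-1) * μ (Bl z l) ^ (q-1) * μ (Bl z l)) * ((σ (Bl z l))⁻¹ * σ (Bl z l)) := by
              rw [ENNReal.mul_rpow_of_nonneg _ _ hq1, rpow_split _ hq.le, hC2]; ring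
          _ = _ := by
              rw [ENNReal.inv_mul_cancel (H.pos _ _) (H.fin _ _), mul_one, setLIntegral_const]
    _ = C1 * (C2 * ∫⁻ y, ∫⁻ z in Bl y l, K l z ^ (q-1) * μ (Bl z l) ^ (q-1) ∂σ ∂μ) := by
        rw [lintegral_const_mul' _ _ hC2t, swap_Bl _ _ _ hm2]
    _ ≤ C1 * (C2 * ∫⁻ y, D ^ (q-1) * (σ (Bl y l) * (K l y * μ (Bl y (l+1))) ^ (q-1)) ∂μ) := by
        refine mul_le_mul' le_rfl (mul_le_mul' le_rfl (lintegral_mono fun y => ?_))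
        calc ∫⁻ z in Bl y l, K l z ^ (q-1) * μ (Bl z l) ^ (q-1) ∂σ
            ≤ ∫⁻ z in Bl y l, (D * K l y) ^ (q-1) * μ (Bl y (l+1)) ^ (q-1) ∂σ := by
              refine setLIntegral_mono' (measurableSet_Bl _ _) fun z hz => ?_
              refine mul_le_mul' (ENNReal.rpow_le_rpow (H.lbo _ _ _ hz) hq1)
                (ENNReal.rpow_le_rpow (measure_mono ?_) hq1)
              exact Bl_subset hz _ le_rfl le_rfl
          _ = _ := by
              rw [setLIntegral_const, ENNReal.mul_rpow_of_nonneg _ _ hq1,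
                ENNReal.mul_rpow_of_nonneg _ _ hq1]; ring
    _ = _ := by
        rw [lintegral_const_mul' _ _ hDq]; ring

/-- partial sums -/
def _root_.SS (b : ℤ → ℝ≥0∞) (μ : Measure (Euc n)) (s : Finset ℤ) (a : ℤ) (x : Euc n) : ℝ≥0∞ :=
  ∑ i ∈ s, b i * μ (Bl x (i + a))

lemma _root_.measurable_SS (μ : Measure (Euc n)) [SFinite μ] (s : Finset ℤ) (a : ℤ) :
    Measurable (SS b μ s a) :=
  Finset.measurable_sum _ fun i _ => (measurable_Bl μ (i+a)).const_mul _

lemma avgS (H : Hyp σ b K D) [SFinite σ] (μ : Measure (Euc n)) [SFinite μ] (s : Finset ℤ) (j : ℤ)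
    (hs : ∀ i ∈ s, i ≤ j) (z : Euc n) :
    (σ (Bl z j))⁻¹ * ∫⁻ x in Bl z j, SS b μ s 1 x ∂σ ≤ D ^ 10 * (K j z * μ (Bl z (j+2))) := by
  have hsum : ∫⁻ x in Bl z j, SS b μ s 1 x ∂σ ≤ D ^ 10 * (σ (Bl z j) * (K j z * μ (Bl z (j+2)))) := by
    unfold SS
    rw [lintegral_finsetSum _ fun i _ => (measurable_Bl μ (i+1)).const_mul _]
    calc ∑ i ∈ s, ∫⁻ x in Bl z j, b i * μ (Bl x (i+1)) ∂σ
        ≤ ∑ i ∈ s, ∫⁻ w in Bl z (j+2), D * (b i * σ (Bl w i)) ∂μ := by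
          refine Finset.sum_le_sum fun i hi => ?_
          have hij := hs i hi
          calc ∫⁻ x in Bl z j, b i * μ (Bl x (i+1)) ∂σ
              = ∫⁻ x in Bl z j, (∫⁻ w in Bl x (i+1), b i ∂(μ.restrict (Bl z (j+2)))) ∂σ := by
                refine setLIntegral_congr_fun (measurableSet_Bl _ _) fun x hx => ?_
                rw [setLIntegral_const, Measure.restrict_apply (measurableSet_Bl _ _),
                  inter_eq_self_of_subset_left]
                apply Bl_subset hx <;> omega
            _ = ∫⁻ w in Bl z (j+2), (∫⁻ x in Bl w (i+1), b i ∂(σ.restrict (Bl z j))) ∂μ :=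
                swap_Bl _ _ _ (f := fun _ _ => b i) measurable_const
            _ ≤ _ := by
                refine lintegral_mono fun w => ?_
                rw [setLIntegral_const]
                calc _ ≤ b i * (D * σ (Bl w i)) :=
                      mul_le_mul' le_rfl ((Measure.restrict_apply_le _ _).trans (H.dbl w i))
                  _ = _ := by ring
      _ = ∫⁻ w in Bl z (j+2), D * ∑ i ∈ s, (b i * σ (Bl w i)) ∂μ := by
          rw [← lintegral_finsetSum _ fun i _ => ((measurable_Bl σ i).const_mul _).const_mul _]
          simp only [Finset.mul_sum]
      _ ≤ ∫⁻ w in Bl z (j+2), D * (D * (D ^ 5 * K j z * (D ^ 3 * σ (Bl z j)))) ∂μ := by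
          refine setLIntegral_mono' (measurableSet_Bl _ _) fun w hw => ?_
          refine mul_le_mul' le_rfl ((H.sumK w j s hs).trans ?_)
          refine mul_le_mul' le_rfl (mul_le_mul' ?_ ?_)
          · exact H.K_comp 2 (by exact_mod_cast hw)
          · exact H.toDbl.comp 2 (by exact_mod_cast hw)
      _ = _ := by
          rw [setLIntegral_const]; ring
  calc _ ≤ (σ (Bl z j))⁻¹ * (D ^ 10 * (σ (Bl z j) * (K j z * μ (Bl z (j+2))))) :=
        mul_le_mul' le_rfl hsum
    _ = ((σ (Bl z j))⁻¹ * σ (Bl z j)) * (D ^ 10 * (K j z * μ (Bl z (j+2)))) := by ring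
    _ = _ := by rw [ENNReal.inv_mul_cancel (H.pos _ _) (H.fin _ _), one_mul]

end Hyp
namespace Dbl

variable {n : ℕ} {σ : Measure (Euc n)} {D : ℝ≥0∞}

lemma avg_concave (h : Dbl σ D) (z : Euc n) (j : ℤ) {f : Euc n → ℝ≥0∞} (hf : Measurable f) {r : ℝ}
    (h0 : 0 ≤ r) (h1 : r ≤ 1) :
    (σ (Bl z j))⁻¹ * ∫⁻ x in Bl z j, f x ^ r ∂σ ≤ ((σ (Bl z j))⁻¹ * ∫⁻ x in Bl z j, f x ∂σ) ^ r := by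
  set V := σ (Bl z j)
  have hJ := jensen_concave (σ.restrict (Bl z j)) hf.aemeasurable h0 h1
  rw [Measure.restrict_apply_univ] at hJ
  have hVV : V⁻¹ * V ^ (1-r) = V⁻¹ ^ r := by
    have e : V⁻¹ = V⁻¹ ^ r * V⁻¹ ^ (1-r) := by
      rw [← ENNReal.rpow_add_of_nonneg _ _ h0 (by linarith)]; simp
    conv_lhs => rw [e]
    rw [mul_assoc, ← ENNReal.mul_rpow_of_nonneg _ _ (by linarith),
      ENNReal.inv_mul_cancel (h.pos _ _) (h.fin _ _), ENNReal.one_rpow, mul_one]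
  calc _ ≤ V⁻¹ * (V ^ (1-r) * (∫⁻ x in Bl z j, f x ∂σ) ^ r) := mul_le_mul' le_rfl hJ
    _ = (V⁻¹ * V ^ (1-r)) * (∫⁻ x in Bl z j, f x ∂σ) ^ r := by ring
    _ = _ := by rw [hVV, ENNReal.mul_rpow_of_nonneg _ _ h0]

end Dbl

namespace Hyp

variable {n : ℕ} {σ : Measure (Euc n)} {b : ℤ → ℝ≥0∞} {K : ℤ → Euc n → ℝ≥0∞} {D : ℝ≥0∞}

lemma lower_small (H : Hyp σ b K D) [SFinite σ] {q : ℝ} (hq : 1 < q) (hq2 : q ≤ 2) :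
    ∃ C : ℝ≥0∞, C ≠ ∞ ∧ ∀ (μ : Measure (Euc n)) [IsFiniteMeasure μ] (s : Finset ℤ),
      ∫⁻ x, SS b μ s 1 x ^ q ∂σ ≤
        C * ∑ j ∈ s, b j * ∫⁻ x, K j x ^ (q-1) * μ (Bl x (j+2)) ^ q ∂σ := by
  have hDt := H.ne_top
  have hq1 : 0 ≤ q - 1 := by linarith
  have h10 : (D ^ 10) ^ (q-1) ≠ ∞ := ENNReal.rpow_ne_top_of_nonneg hq1 (by finiteness)
  have h2q : (2:ℝ≥0∞) ^ q ≠ ∞ := ENNReal.rpow_ne_top_of_nonneg (by linarith) (by finiteness)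
  refine ⟨2 ^ q * (D * (D ^ 10) ^ (q-1)), by finiteness, fun μ _ s => ?_⟩
  have hmeas : ∀ j, Measurable fun x => SS b μ (s.filter (· ≤ j)) 1 x ^ (q-1) := fun j =>
    (measurable_SS μ _ 1).pow_const _
  have hμ : ∀ j, Measurable fun x : Euc n => μ (Bl x j) := measurable_Bl μ
  calc ∫⁻ x, SS b μ s 1 x ^ q ∂σ
      ≤ ∫⁻ x, 2 ^ q * ∑ j ∈ s, b j * (μ (Bl x (j+1)) * SS b μ (s.filter (· ≤ j)) 1 x ^ (q-1)) ∂σ := by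
        refine lintegral_mono fun x => ?_
        refine (sum_rpow_le_small s (fun i => b i * μ (Bl x (i+1))) (fun i _ =>
          ENNReal.mul_ne_top (H.b_fin i) (measure_ne_top _ _)) hq).trans (le_of_eq ?_)
        simp only [mul_assoc]; rfl
    _ = 2 ^ q * ∑ j ∈ s, b j * ∫⁻ x, μ (Bl x (j+1)) * SS b μ (s.filter (· ≤ j)) 1 x ^ (q-1) ∂σ := by
        rw [lintegral_const_mul' _ _ h2q, lintegral_finsetSum]
        swap
        · exact fun j _ => ((hμ _).mul (hmeas j)).const_mul _
        congr 1
        refine Finset.sum_congr rfl fun j _ => ?_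
        rw [lintegral_const_mul' _ _ (H.b_fin j)]
    _ ≤ 2 ^ q * ∑ j ∈ s, b j * (D * ((D ^ 10) ^ (q-1) *
          ∫⁻ x, K j x ^ (q-1) * μ (Bl x (j+2)) ^ q ∂σ)) := by
        refine mul_le_mul' le_rfl (Finset.sum_le_sum fun j _ => mul_le_mul' le_rfl ?_)
        refine (H.toDbl.av j (hμ (j+2)) (hmeas j) (fun x z hz => measure_mono
          (Bl_subset (mem_Bl_comm.1 hz) _ (by omega) (by omega)))).trans ?_
        refine mul_le_mul' le_rfl ?_
        rw [← lintegral_const_mul' _ _ h10]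
        refine lintegral_mono fun z => ?_
        calc _ ≤ μ (Bl z (j+2)) * ((D ^ 10) * (K j z * μ (Bl z (j+2)))) ^ (q-1) := by
              refine mul_le_mul' le_rfl ((H.toDbl.avg_concave z j (measurable_SS μ _ 1) hq1
                (by linarith)).trans (ENNReal.rpow_le_rpow ?_ hq1))
              exact H.avgS μ _ j (by simp) z
          _ = _ := by
              rw [ENNReal.mul_rpow_of_nonneg _ _ hq1, ENNReal.mul_rpow_of_nonneg _ _ hq1,
                rpow_split (μ (Bl z (j+2))) hq.le]
              ring
    _ = _ := by
        simp only [Finset.mul_sum]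
        refine Finset.sum_congr rfl fun j _ => ?_
        ring

lemma lower_large1 (H : Hyp σ b K D) [SFinite σ] {q : ℝ} (hq : 2 < q) :
    ∃ C : ℝ≥0∞, C ≠ ∞ ∧ ∀ (μ : Measure (Euc n)) [IsFiniteMeasure μ] (s : Finset ℤ),
      ∫⁻ x, SS b μ s 1 x ^ q ∂σ ≤
        C * ((∑ j ∈ s, b j * ∫⁻ x, K j x ^ (q-1) * μ (Bl x (j+2)) ^ q ∂σ) ^ (1/(q-1)) *
          (∫⁻ x, SS b μ s 2 x ^ q ∂σ) ^ (1 - 1/(q-1))) := by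
  have hDt := H.ne_top
  have hq1 : 0 < q - 1 := by linarith
  have h2q : (2:ℝ≥0∞) ^ q ≠ ∞ := ENNReal.rpow_ne_top_of_nonneg (by linarith) (by finiteness)
  have hr0 : 0 ≤ 1/(q-1) := by positivity
  have hr1 : 1/(q-1) ≤ 1 := by rw [div_le_one hq1]; linarith
  refine ⟨2 ^ q * (2 * (D * D ^ 10)), by finiteness, fun μ _ s => ?_⟩
  have hμ : ∀ j, Measurable fun x : Euc n => μ (Bl x j) := measurable_Bl μ
  have hle : ∀ j, Measurable (SS b μ (s.filter (· ≤ j)) 1) := fun j => measurable_SS μ _ 1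
  have hge : ∀ j a (c : ℝ), Measurable fun x => SS b μ (s.filter (j ≤ ·)) a x ^ c := fun j a c =>
    (measurable_SS μ _ a).pow_const _
  set F : ℤ → Euc n → ℝ≥0∞ := fun j x => b j * (K j x ^ (q-1) * μ (Bl x (j+2)) ^ q) with hFdef
  set G : ℤ → Euc n → ℝ≥0∞ := fun j x => b j * μ (Bl x (j+2)) *
    SS b μ (s.filter (j ≤ ·)) 2 x ^ (q-1) with hGdef
  have hF : ∀ j, Measurable (F j) := fun j =>
    (((H.Kmeas j).pow_const _).mul ((hμ (j+2)).pow_const _)).const_mul _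
  have hG : ∀ j, Measurable (G j) := fun j => ((hμ (j+2)).const_mul _).mul (hge j 2 _)
  calc ∫⁻ x, SS b μ s 1 x ^ q ∂σ
      ≤ ∫⁻ x, 2 ^ q * (2 * ∑ j ∈ s, (b j * μ (Bl x (j+1)) * SS b μ (s.filter (j ≤ ·)) 1 x ^ (q-2))
          * SS b μ (s.filter (· ≤ j)) 1 x) ∂σ := by
        refine lintegral_mono fun x => ?_
        refine (sum_rpow_le_large s (fun i => b i * μ (Bl x (i+1))) (fun i _ =>
          ENNReal.mul_ne_top (H.b_fin i) (measure_ne_top _ _)) hq).trans (le_of_eq ?_)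
        congr 2
        refine Finset.sum_congr rfl fun j _ => ?_
        unfold SS
        ring
    _ = 2 ^ q * (2 * ∑ j ∈ s, ∫⁻ x, (b j * μ (Bl x (j+1)) * SS b μ (s.filter (j ≤ ·)) 1 x ^ (q-2))
          * SS b μ (s.filter (· ≤ j)) 1 x ∂σ) := by
        rw [lintegral_const_mul' _ _ h2q, lintegral_const_mul' _ _ (by finiteness),
          lintegral_finsetSum]
        exact fun j _ => (((hμ _).const_mul _).mul (hge j 1 _)).mul (hle j)
    _ ≤ 2 ^ q * (2 * ∑ j ∈ s, D * (D ^ 10 * ∫⁻ x, F j x ^ (1/(q-1)) * G j x ^ (1 - 1/(q-1)) ∂σ)) := by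
        refine mul_le_mul' le_rfl (mul_le_mul' le_rfl (Finset.sum_le_sum fun j _ => ?_))
        refine (H.toDbl.av j (H2 := fun z => b j * μ (Bl z (j+2)) *
          SS b μ (s.filter (j ≤ ·)) 2 z ^ (q-2)) (((hμ _).const_mul _).mul (hge j 2 _)) (hle j)
          (fun x z hz => ?_)).trans ?_
        · refine mul_le_mul' (mul_le_mul' le_rfl (measure_mono
            (Bl_subset (mem_Bl_comm.1 hz) _ (by omega) (by omega)))) ?_
          refine ENNReal.rpow_le_rpow (Finset.sum_le_sum fun i hi => mul_le_mul' le_rfl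
            (measure_mono ?_)) (by linarith)
          have hi := (Finset.mem_filter.1 hi).2
          exact Bl_subset (mem_Bl_comm.1 hz) _ (by omega) (by omega)
        refine mul_le_mul' le_rfl ?_
        rw [← lintegral_const_mul' _ _ (by finiteness)]
        refine lintegral_mono fun z => ?_
        refine (mul_le_mul' le_rfl (H.avgS μ _ j (by simp) z)).trans (le_of_eq ?_)
        have e1 : F j z ^ (1/(q-1)) = b j ^ (1/(q-1)) * (K j z * μ (Bl z (j+2)) ^ (q/(q-1))) := by
          simp only [hFdef]
          rw [ENNReal.mul_rpow_of_nonneg _ _ hr0, ENNReal.mul_rpow_of_nonneg _ _ hr0,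
            ← ENNReal.rpow_mul, ← ENNReal.rpow_mul, mul_one_div_cancel hq1.ne', ENNReal.rpow_one,
            mul_one_div]
        have e2 : G j z ^ (1 - 1/(q-1)) = b j ^ (1 - 1/(q-1)) * μ (Bl z (j+2)) ^ (1 - 1/(q-1)) *
            SS b μ (s.filter (j ≤ ·)) 2 z ^ (q-2) := by
          simp only [hGdef]
          rw [ENNReal.mul_rpow_of_nonneg _ _ (by linarith), ENNReal.mul_rpow_of_nonneg _ _ (by linarith),
            ← ENNReal.rpow_mul]
          congr 2
          field_simp
          ring
        have e3 : b j ^ (1/(q-1)) * b j ^ (1 - 1/(q-1)) = b j := by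
          rw [← ENNReal.rpow_add_of_nonneg _ _ hr0 (by linarith)]; simp
        have e4 : μ (Bl z (j+2)) ^ (q/(q-1)) * μ (Bl z (j+2)) ^ (1 - 1/(q-1)) =
            μ (Bl z (j+2)) * μ (Bl z (j+2)) := by
          rw [← ENNReal.rpow_add_of_nonneg _ _ (by positivity) (by linarith)]
          have : q/(q-1) + (1 - 1/(q-1)) = ((2:ℕ):ℝ) := by
            field_simp; push_cast; ring
          rw [this, ENNReal.rpow_natCast, sq]
        rw [e1, e2]
        calc _ = D ^ 10 * (b j * (K j z * ((μ (Bl z (j+2)) * μ (Bl z (j+2))) *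
              SS b μ (s.filter (j ≤ ·)) 2 z ^ (q-2)))) := by ring
          _ = _ := by
              rw [← e4]
              nth_rewrite 1 [← e3]
              ring
    _ = 2 ^ q * (2 * (D * D ^ 10)) * ∑ j ∈ s, ∫⁻ x, F j x ^ (1/(q-1)) * G j x ^ (1 - 1/(q-1)) ∂σ := by
        simp only [Finset.mul_sum]
        refine Finset.sum_congr rfl fun j _ => ?_
        ring
    _ ≤ _ := by
        refine mul_le_mul' le_rfl ((holder_sum σ s hF hG hr0 hr1).trans (mul_le_mul' ?_ ?_))
        · refine ENNReal.rpow_le_rpow (Finset.sum_le_sum fun j _ => ?_) hr0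
          simp only [hFdef]
          rw [lintegral_const_mul' _ _ (H.b_fin j)]
        · refine ENNReal.rpow_le_rpow ?_ (by linarith)
          rw [← lintegral_finsetSum _ fun j _ => hG j]
          refine lintegral_mono fun x => ?_
          rw [rpow_split _ (by linarith)]
          conv_rhs => enter [1]; unfold SS
          rw [Finset.sum_mul]
          refine Finset.sum_le_sum fun j _ => mul_le_mul' le_rfl (ENNReal.rpow_le_rpow ?_ hq1.le)
          exact Finset.sum_le_sum_of_subset (Finset.filter_subset _ _)

lemma _root_.Dbl.SS_fin (H : Dbl σ D) (hb : ∀ j, b j ≠ ∞) {q : ℝ} (hq : 1 < q) (μ : Measure (Euc n))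
    [IsFiniteMeasure μ] (J : ℤ) (hJ : μ (Bl 0 J)ᶜ = 0) (s : Finset ℤ) :
    ∫⁻ x, SS b μ s 2 x ^ q ∂σ ≠ ∞ := by
  obtain ⟨N, hN⟩ : ∃ N : ℤ, J < N ∧ ∀ i ∈ s, i + 2 < N := by
    obtain ⟨N, hN⟩ := (insert J (s.image (· + 2))).bddAbove
    refine ⟨N + 1, ?_, fun i hi => ?_⟩
    · have := hN (Finset.mem_coe.2 (Finset.mem_insert_self _ _)); omega
    · have := hN (Finset.mem_coe.2 (Finset.mem_insert_of_mem (Finset.mem_image_of_mem (· + 2) hi)))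
      omega
  set M := ∑ i ∈ s, b i * μ univ
  have hM : M ≠ ∞ := ENNReal.sum_ne_top.2 fun i _ => ENNReal.mul_ne_top (hb i) (measure_ne_top _ _)
  have hbd : ∀ x, SS b μ s 2 x ^ q ≤ (Bl (0 : Euc n) N).indicator (fun _ => M ^ q) x := by
    intro x
    by_cases hx : x ∈ Bl (0 : Euc n) N
    · rw [indicator_of_mem hx]
      exact ENNReal.rpow_le_rpow (Finset.sum_le_sum fun i _ => mul_le_mul' le_rfl
        (measure_mono (subset_univ _))) (by linarith)
    · have : SS b μ s 2 x = 0 := by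
        refine Finset.sum_eq_zero fun i hi => ?_
        have : μ (Bl x (i+2)) = 0 := by
          refine measure_mono_null (fun y hy => ?_) hJ
          intro hy'
          exact hx (mem_Bl_trans (mem_Bl_comm.1 hy) hy' N (by have := hN.2 i hi; omega) (by omega))
        rw [this, mul_zero]
      rw [this, ENNReal.zero_rpow_of_pos (by linarith)]
      exact zero_le
  refine ne_top_of_le_ne_top ?_ (lintegral_mono hbd)
  rw [lintegral_indicator (measurableSet_Bl _ _), setLIntegral_const]
  exact ENNReal.mul_ne_top (ENNReal.rpow_ne_top_of_nonneg (by linarith) hM) (H.fin _ _)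

lemma _root_.Dbl.SS_two (H : Dbl σ D) [SFinite σ] (hb : ∀ j, b j ≠ ∞) {q : ℝ} (hq : 1 < q) :
    ∃ C : ℝ≥0∞, C ≠ ∞ ∧ ∀ (μ : Measure (Euc n)) [IsFiniteMeasure μ] (J : ℤ) (_ : μ (Bl 0 J)ᶜ = 0)
      (s : Finset ℤ), ∫⁻ x, SS b μ s 2 x ^ q ∂σ ≤ C * ∫⁻ x, SS b μ s 1 x ^ q ∂σ := by
  have hDt := H.ne_top
  have hq1 : 0 < q - 1 := by linarith
  have hq0 : 0 < q := by linarith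
  have hqq : 1 < q / (q-1) := by rw [lt_div_iff₀ hq1]; linarith
  have hr1 : 1/q ≤ 1 := by rw [div_le_one hq0]; linarith
  obtain ⟨Cs, hCs, hstrong⟩ := H.strong hqq
  have hCs' : Cs ^ (1 - 1/q) ≠ ∞ := ENNReal.rpow_ne_top_of_nonneg (by linarith) hCs
  refine ⟨(D ^ 7 * Cs ^ (1 - 1/q)) ^ (1/(1/q)), ENNReal.rpow_ne_top_of_nonneg (by positivity)
    (by finiteness), fun μ _ J hJ s => ?_⟩
  refine absorb (by positivity) hr1 (H.SS_fin hb hq μ J hJ s) ?_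
  have hμ : ∀ j, Measurable fun x : Euc n => μ (Bl x j) := measurable_Bl μ
  have hS1 : Measurable (SS b μ s 1) := measurable_SS μ s 1
  set g : Euc n → ℝ≥0∞ := fun x => SS b μ s 2 x ^ (q-1) with hg
  have hgm : Measurable g := (measurable_SS μ s 2).pow_const _
  have hMg := measurable_Mx (σ := σ) hgm
  calc ∫⁻ x, SS b μ s 2 x ^ q ∂σ = ∫⁻ x, ∑ j ∈ s, b j * (μ (Bl x (j+2)) * g x) ∂σ := by
        refine lintegral_congr fun x => ?_
        rw [rpow_split _ hq.le]
        conv_lhs => enter [1]; unfold SS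
        rw [Finset.sum_mul]
        simp only [mul_assoc, hg]
    _ = ∑ j ∈ s, b j * ∫⁻ x, μ (Bl x (j+2)) * g x ∂σ := by
        rw [lintegral_finsetSum]
        swap
        · exact fun j _ => ((hμ _).mul hgm).const_mul _
        refine Finset.sum_congr rfl fun j _ => ?_
        rw [lintegral_const_mul' _ _ (hb j)]
    _ ≤ ∑ j ∈ s, b j * (D ^ 7 * ∫⁻ x, μ (Bl x (j+1)) * Mx σ g x ∂σ) := by
        refine Finset.sum_le_sum fun j _ => mul_le_mul' le_rfl ?_
        have := H.dualD μ (j+1) 1 hgm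
        simpa [add_assoc] using this
    _ = D ^ 7 * ∑ j ∈ s, b j * ∫⁻ x, μ (Bl x (j+1)) * Mx σ g x ∂σ := by
        rw [Finset.mul_sum]
        refine Finset.sum_congr rfl fun j _ => ?_
        ring
    _ = D ^ 7 * ∫⁻ x, (SS b μ s 1 x ^ q) ^ (1/q) * (Mx σ g x ^ (q/(q-1))) ^ (1 - 1/q) ∂σ := by
        congr 1
        have e : ∀ x, (SS b μ s 1 x ^ q) ^ (1/q) * (Mx σ g x ^ (q/(q-1))) ^ (1 - 1/q) =
            ∑ j ∈ s, b j * (μ (Bl x (j+1)) * Mx σ g x) := by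
          intro x
          rw [← ENNReal.rpow_mul, ← ENNReal.rpow_mul, mul_one_div_cancel hq0.ne',
            show q/(q-1) * (1 - 1/q) = 1 by field_simp, ENNReal.rpow_one, ENNReal.rpow_one]
          unfold SS
          rw [Finset.sum_mul]
          simp only [mul_assoc]
        simp only [e]
        rw [lintegral_finsetSum]
        swap
        · exact fun j _ => ((hμ _).mul hMg).const_mul _
        refine Finset.sum_congr rfl fun j _ => ?_
        rw [lintegral_const_mul' _ _ (hb j)]
    _ ≤ D ^ 7 * ((∫⁻ x, SS b μ s 1 x ^ q ∂σ) ^ (1/q) *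
          (∫⁻ x, Mx σ g x ^ (q/(q-1)) ∂σ) ^ (1 - 1/q)) := by
        refine mul_le_mul' le_rfl ?_
        exact lintegral_mul_norm_pow_le (hS1.pow_const _).aemeasurable (hMg.pow_const _).aemeasurable
          (by positivity) (by linarith) (by ring)
    _ ≤ D ^ 7 * ((∫⁻ x, SS b μ s 1 x ^ q ∂σ) ^ (1/q) *
          (Cs * ∫⁻ x, SS b μ s 2 x ^ q ∂σ) ^ (1 - 1/q)) := by
        refine mul_le_mul' le_rfl (mul_le_mul' le_rfl (ENNReal.rpow_le_rpow ?_ (by linarith)))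
        refine (hstrong g hgm).trans (le_of_eq ?_)
        congr 1
        refine lintegral_congr fun x => ?_
        simp only [hg]
        rw [← ENNReal.rpow_mul]
        congr 1
        field_simp
    _ = _ := by
        rw [ENNReal.mul_rpow_of_nonneg _ _ (by linarith : 0 ≤ 1 - 1/q)]; ring

lemma lower (H : Hyp σ b K D) [SFinite σ] {q : ℝ} (hq : 1 < q) :
    ∃ C : ℝ≥0∞, C ≠ ∞ ∧ ∀ (μ : Measure (Euc n)) [IsFiniteMeasure μ] (J : ℤ) (_ : μ (Bl 0 J)ᶜ = 0)
      (s : Finset ℤ), ∫⁻ x, SS b μ s 1 x ^ q ∂σ ≤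
        C * ∑ j ∈ s, b j * ∫⁻ x, K j x ^ (q-1) * μ (Bl x (j+2)) ^ q ∂σ := by
  rcases le_or_gt q 2 with h2 | h2
  · obtain ⟨C, hC, h⟩ := H.lower_small hq h2
    exact ⟨C, hC, fun μ _ _ _ s => h μ s⟩
  obtain ⟨C1, hC1, h1⟩ := H.lower_large1 h2
  obtain ⟨C2, hC2, hh2⟩ := H.toDbl.SS_two H.b_fin hq
  have hq1 : 0 < q - 1 := by linarith
  refine ⟨(C2 * C1) ^ (1/(1/(q-1))), ENNReal.rpow_ne_top_of_nonneg (by positivity) (by finiteness),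
    fun μ _ J hJ s => ?_⟩
  refine le_trans (lintegral_mono fun x => ?_) (absorb (α := 1/(q-1)) (by positivity)
    (by rw [div_le_one hq1]; linarith) (H.toDbl.SS_fin H.b_fin hq μ J hJ s)
    ((hh2 μ J hJ s).trans ((mul_le_mul' le_rfl (h1 μ s)).trans (le_of_eq (by ring)))))
  refine ENNReal.rpow_le_rpow (Finset.sum_le_sum fun i _ => mul_le_mul' le_rfl
    (measure_mono (Bl_mono _ (by omega)))) (by linarith)

end Hyp
/-! ### The concrete setting -/

section concrete

variable {n : ℕ}

lemma Dbl_of_Doubling {σ : Measure (Euc n)} [IsLocallyFiniteMeasure σ] (hσ : Doubling n σ) :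
    σ = 0 ∨ ∃ D, Dbl σ D := by
  obtain ⟨C₀, hC, h⟩ := hσ
  have hd : ∀ x (j : ℤ), σ (Bl x (j+1)) ≤ max (ENNReal.ofReal C₀) 1 * σ (Bl x j) := by
    intro x j
    have := h x ((2:ℝ)^j) (two_zpow_pos j)
    unfold Bl
    rw [two_zpow_succ]
    refine this.trans (mul_le_mul' (le_max_left _ _) le_rfl)
  by_cases h0 : ∀ x (j : ℤ), σ (Bl x j) ≠ 0
  · refine Or.inr ⟨max (ENNReal.ofReal C₀) 1, le_max_right _ _, by simp, h0, fun x j => ?_, hd⟩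
    exact measure_ball_lt_top.ne
  · left
    push Not at h0
    obtain ⟨x, j, hx⟩ := h0
    have hz : ∀ a : ℕ, σ (Bl x (j + a)) = 0 := by
      intro a
      induction a with
      | zero => simpa using hx
      | succ a ih =>
        have := hd x (j+a)
        rw [ih, mul_zero] at this
        push_cast
        rw [← add_assoc]
        exact le_antisymm this zero_le
    rw [← Measure.measure_univ_eq_zero]
    refine measure_mono_null (fun y _ => ?_) (measure_iUnion_null hz)
    obtain ⟨N, hN⟩ := pow_unbounded_of_one_lt (dist y x / (2:ℝ)^j) (one_lt_two : (1:ℝ) < 2)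
    refine mem_iUnion.2 ⟨N, ?_⟩
    rw [mem_Bl, zpow_add₀ (by norm_num), zpow_natCast, mul_comm]
    rwa [div_lt_iff₀ (two_zpow_pos j)] at hN

lemma Dbl.mono {σ : Measure (Euc n)} {D D' : ℝ≥0∞} (h : Dbl σ D) (hD : D ≤ D') (ht : D' ≠ ∞) :
    Dbl σ D' :=
  ⟨h.one_le.trans hD, ht, h.pos, h.fin, fun x j => (h.dbl x j).trans (mul_le_mul' hD le_rfl)⟩

def Ann (x : Euc n) (j : ℤ) : Set (Euc n) := Bl x (j+1) \ Bl x j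

lemma measurableSet_Ann (x : Euc n) (j : ℤ) : MeasurableSet (Ann x j) :=
  (measurableSet_Bl _ _).diff (measurableSet_Bl _ _)

lemma mem_Ann {x y : Euc n} {j : ℤ} : y ∈ Ann x j ↔ (2:ℝ)^j ≤ dist y x ∧ dist y x < (2:ℝ)^(j+1) := by
  unfold Ann
  rw [mem_sdiff, mem_Bl, mem_Bl, not_lt, and_comm]

lemma dyadic_unique {i j : ℤ} {s : ℝ} (h1 : (2:ℝ)^i ≤ s) (h2 : s < (2:ℝ)^(i+1))
    (h3 : (2:ℝ)^j ≤ s) (h4 : s < (2:ℝ)^(j+1)) : i = j := by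
  have a : i < j + 1 := (zpow_lt_zpow_iff_right₀ (one_lt_two : (1:ℝ) < 2)).1 (h1.trans_lt h4)
  have b : j < i + 1 := (zpow_lt_zpow_iff_right₀ (one_lt_two : (1:ℝ) < 2)).1 (h3.trans_lt h2)
  omega

lemma disj_Ann (x : Euc n) : Pairwise (Function.onFun Disjoint (Ann x)) := by
  intro i j hij
  refine Set.disjoint_left.2 fun y h1 h2 => hij ?_
  rw [mem_Ann] at h1 h2
  exact dyadic_unique h1.1 h1.2 h2.1 h2.2

lemma Dbl.ann {σ : Measure (Euc n)} {D : ℝ≥0∞} (h : Dbl σ D) (hn : 0 < n) (x : Euc n) (j : ℤ) :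
    σ (Bl x (j+1)) ≤ D ^ 3 * σ (Ann x j) := by
  have hne : Nonempty (Fin n) := ⟨⟨0, hn⟩⟩
  have hnt : Nontrivial (Euc n) := inferInstance
  obtain ⟨e, he⟩ := exists_norm_eq (Euc n) (show (0:ℝ) ≤ 3/2 * (2:ℝ)^j by positivity)
  have hp := two_zpow_pos j
  have hw : dist x (x + e) = 3/2 * (2:ℝ)^j := by simp [he]
  have h1 : x ∈ Bl (x + e) (j+1) := by
    rw [mem_Bl, hw, two_zpow_succ]; linarith
  have h2 : Bl x (j+1) ⊆ Bl (x+e) ((j-1) + (3:ℕ)) := Bl_subset h1 _ (by push_cast; omega) (by push_cast; omega)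
  have h3 : Bl (x+e) (j-1) ⊆ Ann x j := by
    intro y hy
    have e1 : (2:ℝ)^j = 2 * (2:ℝ)^(j-1) := by rw [← two_zpow_succ]; congr 1; ring
    rw [mem_Bl] at hy
    rw [mem_Ann, two_zpow_succ]
    have t1 := dist_triangle y (x+e) x
    have t2 := dist_triangle x y (x+e)
    rw [dist_comm (x+e) x] at t1
    rw [dist_comm x y] at t2
    constructor <;> linarith
  calc σ (Bl x (j+1)) ≤ σ (Bl (x+e) ((j-1) + (3:ℕ))) := measure_mono h2
    _ ≤ D ^ 3 * σ (Bl (x+e) (j-1)) := h.shift _ _ 3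
    _ ≤ _ := mul_le_mul' le_rfl (measure_mono h3)

lemma Dbl.no_atom {σ : Measure (Euc n)} {D : ℝ≥0∞} (h : Dbl σ D) (hn : 0 < n) (x : Euc n) :
    σ {x} = 0 := by
  by_contra hx
  have h1 : ∑' m : ℕ, D ^ 3 * σ (Ann x (-(m:ℤ)-1)) ≠ ∞ := by
    rw [ENNReal.tsum_mul_left]
    refine ENNReal.mul_ne_top (by have := h.ne_top; finiteness) ?_
    rw [← measure_iUnion (f := fun m : ℕ => Ann x (-(m:ℤ)-1))
      (fun i j hij => disj_Ann x (by omega)) fun _ => measurableSet_Ann _ _]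
    refine ne_top_of_le_ne_top (h.fin x 0) (measure_mono (iUnion_subset fun m => ?_))
    exact sdiff_subset.trans (Bl_mono _ (by omega))
  refine h1 (top_unique ?_)
  rw [← ENNReal.tsum_const_eq_top_of_ne_zero (α := ℕ) hx]
  refine ENNReal.tsum_le_tsum fun m => ?_
  refine le_trans (measure_mono ?_) (h.ann hn x _)
  exact singleton_subset_iff.2 (self_mem_Bl _ _)

/-- Dyadic values of the kernel -/
def bb (k : ℝ → ℝ) (j : ℤ) : ℝ≥0∞ := ENNReal.ofReal (k ((2:ℝ)^j))

/-- truncated kernel -/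
def ff (k : ℝ → ℝ) (d : ℝ) : ℝ≥0∞ := if 0 < d then ENNReal.ofReal (k d) else 0

lemma measurable_ff {k : ℝ → ℝ} (hmono : AntitoneOn k (Ioi (0:ℝ))) : Measurable (ff k) := by
  have hg : Antitone fun t : ℝ => ENNReal.ofReal (k (Real.exp t)) := by
    intro s t hst
    exact ENNReal.ofReal_le_ofReal (hmono (Real.exp_pos _) (Real.exp_pos _) (Real.exp_le_exp.2 hst))
  have : ff k = fun d => if 0 < d then (fun t : ℝ => ENNReal.ofReal (k (Real.exp t))) (Real.log d) else 0 := by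
    ext d
    unfold ff
    split_ifs with hd
    · simp only [Real.exp_log hd]
    · rfl
  rw [this]
  exact Measurable.ite measurableSet_Ioi (hg.measurable.comp Real.measurable_log) measurable_const

/-- dyadic interval -/
def Dy (i : ℤ) : Set ℝ := Ico ((2:ℝ)^i) ((2:ℝ)^(i+1))

lemma measurableSet_Dy (i : ℤ) : MeasurableSet (Dy i) := measurableSet_Ico

lemma disj_Dy : Pairwise (Function.onFun Disjoint Dy) := by
  intro i j hij
  refine Set.disjoint_left.2 fun y h1 h2 => hij ?_
  exact dyadic_unique h1.1 h1.2 h2.1 h2.2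

lemma exists_Dy {s : ℝ} (hs : 0 < s) : ∃ i : ℤ, s ∈ Dy i :=
  exists_mem_Ico_zpow hs one_lt_two

lemma iUnion_Dy : ⋃ i, Dy i = Ioi (0:ℝ) := by
  ext s
  rw [mem_iUnion]
  exact ⟨fun ⟨i, hi⟩ => (two_zpow_pos i).trans_le hi.1, fun hs => exists_Dy hs⟩

lemma volume_Dy (i : ℤ) : volume (Dy i) = ENNReal.ofReal ((2:ℝ)^i) := by
  unfold Dy
  rw [Real.volume_Ico, two_zpow_succ]
  congr 1; ring

lemma dy_le {k : ℝ → ℝ} (hk0 : ∀ r ∈ Ioi (0:ℝ), 0 ≤ k r) (hmono : AntitoneOn k (Ioi (0:ℝ)))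
    (i : ℤ) (φ : ℝ → ℝ≥0∞) (M : ℝ≥0∞) (h : ∀ s ∈ Dy i, φ s ≤ M) :
    ∫⁻ s in Dy i, ENNReal.ofReal (k s / s) * φ s ≤ bb k i * M := by
  have hp := two_zpow_pos i
  calc _ ≤ ∫⁻ s in Dy i, ENNReal.ofReal (k ((2:ℝ)^i) / (2:ℝ)^i) * M := by
        refine setLIntegral_mono' (measurableSet_Dy i) fun s hs => mul_le_mul' ?_ (h s hs)
        refine ENNReal.ofReal_le_ofReal ?_
        have hs0 : 0 < s := hp.trans_le hs.1
        exact div_le_div₀ (hk0 _ hp) (hmono hp hs0 hs.1) hp hs.1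
    _ = _ := by
        rw [setLIntegral_const, volume_Dy, mul_right_comm, ← ENNReal.ofReal_mul
          (div_nonneg (hk0 _ hp) hp.le), div_mul_cancel₀ _ hp.ne']
        rfl

lemma dy_ge {k : ℝ → ℝ} (hk0 : ∀ r ∈ Ioi (0:ℝ), 0 ≤ k r) (hmono : AntitoneOn k (Ioi (0:ℝ)))
    (i : ℤ) (φ : ℝ → ℝ≥0∞) (M : ℝ≥0∞) (h : ∀ s ∈ Dy i, M ≤ φ s) :
    bb k (i+1) * M ≤ 2 * ∫⁻ s in Dy i, ENNReal.ofReal (k s / s) * φ s := by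
  have hp := two_zpow_pos i
  have hp1 := two_zpow_pos (i+1)
  calc bb k (i+1) * M = 2 * ∫⁻ s in Dy i, ENNReal.ofReal (k ((2:ℝ)^(i+1)) / (2:ℝ)^(i+1)) * M := by
        rw [setLIntegral_const, volume_Dy, mul_right_comm, ← ENNReal.ofReal_mul
          (div_nonneg (hk0 _ hp1) hp1.le), ← mul_assoc]
        congr 1
        unfold bb
        rw [show (2:ℝ≥0∞) = ENNReal.ofReal 2 by simp, ← ENNReal.ofReal_mul (by norm_num)]
        congr 1
        rw [two_zpow_succ]
        field_simp
    _ ≤ _ := by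
        refine mul_le_mul' le_rfl (setLIntegral_mono' (measurableSet_Dy i) fun s hs =>
          mul_le_mul' ?_ (h s hs))
        refine ENNReal.ofReal_le_ofReal ?_
        have hs0 : 0 < s := hp.trans_le hs.1
        exact div_le_div₀ (hk0 _ hs0) (hmono hs0 hp1 hs.2.le) hs0 hs.2.le

/-- the integral in the definition of `kbar` -/
def II (σ : Measure (Euc n)) (k : ℝ → ℝ) (r : ℝ) (x : Euc n) : ℝ≥0∞ :=
  ∫⁻ s in Ioo (0:ℝ) r, ENNReal.ofReal (k s / s) * σ (ball x s)

lemma II_mono (σ : Measure (Euc n)) (k : ℝ → ℝ) {r r' : ℝ} (h : r ≤ r') (x : Euc n) :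
    II σ k r x ≤ II σ k r' x :=
  lintegral_mono_set (Ioo_subset_Ioo_right h)

def KK (σ : Measure (Euc n)) (k : ℝ → ℝ) (j : ℤ) (x : Euc n) : ℝ≥0∞ := kbar n σ k ((2:ℝ)^j) x

lemma KK_eq (σ : Measure (Euc n)) (k : ℝ → ℝ) (j : ℤ) (x : Euc n) :
    KK σ k j x = (σ (Bl x j))⁻¹ * II σ k ((2:ℝ)^j) x := rfl

lemma KK_mul {σ : Measure (Euc n)} {D : ℝ≥0∞} (h : Dbl σ D) (k : ℝ → ℝ) (j : ℤ) (x : Euc n) :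
    KK σ k j x * σ (Bl x j) = II σ k ((2:ℝ)^j) x := by
  rw [KK_eq, mul_right_comm, ENNReal.inv_mul_cancel (h.pos _ _) (h.fin _ _), one_mul]

lemma measurable_ball_prod (σ : Measure (Euc n)) [SFinite σ] :
    Measurable fun w : Euc n × ℝ => σ (ball w.1 w.2) := by
  have hs : MeasurableSet {w : (Euc n × ℝ) × Euc n | dist w.2 w.1.1 < w.1.2} :=
    measurableSet_lt (by fun_prop) (by fun_prop)
  exact measurable_measure_prodMk_left hs

lemma measurable_KK (σ : Measure (Euc n)) [SFinite σ] {k : ℝ → ℝ}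
    (hmono : AntitoneOn k (Ioi (0:ℝ))) (j : ℤ) : Measurable (KK σ k j) := by
  have h1 : Measurable (II σ k ((2:ℝ)^j)) := by
    have e : II σ k ((2:ℝ)^j) = fun x => ∫⁻ s in Ioo (0:ℝ) ((2:ℝ)^j),
        (ff k s * ENNReal.ofReal (s⁻¹)) * σ (ball x s) := by
      ext x
      refine setLIntegral_congr_fun measurableSet_Ioo fun s hs => ?_
      have : ENNReal.ofReal (k s / s) = ff k s * ENNReal.ofReal (s⁻¹) := by
        rw [ff, if_pos hs.1, ← ENNReal.ofReal_mul' (inv_nonneg.2 hs.1.le), div_eq_mul_inv]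
      simp only [this]
    rw [e]
    refine Measurable.lintegral_prod_right' (f := fun w : Euc n × ℝ =>
      (ff k w.2 * ENNReal.ofReal (w.2⁻¹)) * σ (ball w.1 w.2)) ?_
    exact (((measurable_ff hmono).comp measurable_snd).mul (by fun_prop)).mul (measurable_ball_prod σ)
  exact (measurable_Bl σ j).inv.mul h1

lemma Dbl.inv_dbl {σ : Measure (Euc n)} {D : ℝ≥0∞} (h : Dbl σ D) (x : Euc n) (j : ℤ) :
    (σ (Bl x j))⁻¹ ≤ D * (σ (Bl x (j+1)))⁻¹ := by
  have := h.dbl x j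
  rw [ENNReal.inv_le_iff_inv_le, ENNReal.mul_inv (Or.inr (by simp [h.pos]))
    (Or.inr (by simp [h.fin])), inv_inv, ← ENNReal.div_eq_inv_mul]
  exact ENNReal.div_le_of_le_mul' this

lemma sumK_aux {σ : Measure (Euc n)} {D : ℝ≥0∞} (h : Dbl σ D) {k : ℝ → ℝ}
    (hk0 : ∀ r ∈ Ioi (0:ℝ), 0 ≤ k r) (hmono : AntitoneOn k (Ioi (0:ℝ))) (x : Euc n) (j : ℤ)
    (s : Finset ℤ) (hs : ∀ i ∈ s, i ≤ j) :
    ∑ i ∈ s, bb k i * σ (Bl x i) ≤ (2 * D) * II σ k ((2:ℝ)^j) x := by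
  calc ∑ i ∈ s, bb k i * σ (Bl x i)
      ≤ ∑ i ∈ s, (2 * D) * ∫⁻ t in Dy (i-1), ENNReal.ofReal (k t / t) * σ (ball x t) := by
        refine Finset.sum_le_sum fun i hi => ?_
        have h1 := dy_ge hk0 hmono (i-1) (fun t => σ (ball x t)) (σ (Bl x (i-1)))
          (fun t ht => measure_mono (ball_subset_ball ht.1))
        have h2 := h.dbl x (i-1)
        rw [sub_add_cancel] at h1 h2
        calc bb k i * σ (Bl x i) ≤ bb k i * (D * σ (Bl x (i-1))) := mul_le_mul' le_rfl h2
          _ = D * (bb k i * σ (Bl x (i-1))) := by ring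
          _ ≤ D * (2 * ∫⁻ t in Dy (i-1), ENNReal.ofReal (k t / t) * σ (ball x t)) :=
              mul_le_mul' le_rfl h1
          _ = _ := by ring
    _ = (2 * D) * ∫⁻ t in ⋃ i ∈ s, Dy (i-1), ENNReal.ofReal (k t / t) * σ (ball x t) := by
        rw [lintegral_biUnion_finset, Finset.mul_sum]
        · intro a _ c _ hac
          exact disj_Dy (by omega)
        · exact fun i _ => measurableSet_Dy _
    _ ≤ _ := by
        refine mul_le_mul' le_rfl (lintegral_mono_set (iUnion₂_subset fun i hi t ht => ?_))
        refine ⟨(two_zpow_pos _).trans_le ht.1, ht.2.trans_le ?_⟩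
        have := hs i hi
        exact two_zpow_mono (by omega)

lemma II_succ_le {σ : Measure (Euc n)} {D : ℝ≥0∞} (h : Dbl σ D) {k : ℝ → ℝ}
    (hk0 : ∀ r ∈ Ioi (0:ℝ), 0 ≤ k r) (hmono : AntitoneOn k (Ioi (0:ℝ))) (x : Euc n) (j : ℤ) :
    II σ k ((2:ℝ)^(j+1)) x ≤ (1 + 2 * D ^ 2) * II σ k ((2:ℝ)^j) x := by
  have h1 : II σ k ((2:ℝ)^(j+1)) x ≤ II σ k ((2:ℝ)^j) x +
      ∫⁻ t in Dy j, ENNReal.ofReal (k t / t) * σ (ball x t) := by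
    unfold II
    refine (lintegral_mono_set ?_).trans (lintegral_union_le _ _ _)
    intro t ht
    rcases lt_or_ge t ((2:ℝ)^j) with h | h
    · exact Or.inl ⟨ht.1, h⟩
    · exact Or.inr ⟨h, ht.2⟩
  have h2 := dy_le hk0 hmono j (fun t => σ (ball x t)) (σ (Bl x (j+1)))
    (fun t ht => measure_mono (ball_subset_ball ht.2.le))
  have h3 := sumK_aux h hk0 hmono x j {j} (by simp)
  rw [Finset.sum_singleton] at h3
  calc _ ≤ _ := h1
    _ ≤ II σ k ((2:ℝ)^j) x + D * (bb k j * σ (Bl x j)) := by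
        refine add_le_add le_rfl (h2.trans ?_)
        calc _ ≤ bb k j * (D * σ (Bl x j)) := mul_le_mul' le_rfl (h.dbl x j)
          _ = _ := by ring
    _ ≤ II σ k ((2:ℝ)^j) x + D * ((2 * D) * II σ k ((2:ℝ)^j) x) :=
        add_le_add le_rfl (mul_le_mul' le_rfl h3)
    _ = _ := by ring

lemma exists_Hyp {σ : Measure (Euc n)} [SFinite σ] {D : ℝ≥0∞} (h : Dbl σ D) {k : ℝ → ℝ}
    (hk0 : ∀ r ∈ Ioi (0:ℝ), 0 ≤ k r) (hmono : AntitoneOn k (Ioi (0:ℝ))) (hLBO : LBO n σ k) :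
    ∃ D', Hyp σ (bb k) (KK σ k) D' := by
  obtain ⟨A, hA, hL⟩ := hLBO
  have ht := h.ne_top
  have h1 := h.one_le
  have hDD : D ≤ 2 * D ^ 2 := by
    calc D = 1 * (D * 1) := by ring
      _ ≤ 2 * (D * D) := by gcongr; exact one_le_two
      _ = _ := by ring
  have hD1 : 1 + 2 * D ^ 2 ≤ 1 + 2 * D ^ 2 + ENNReal.ofReal A := le_self_add
  have hD2 : 2 * D ^ 2 ≤ 1 + 2 * D ^ 2 + ENNReal.ofReal A := le_add_self.trans hD1
  have hh := h.mono (hDD.trans hD2) (by finiteness)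
  refine ⟨1 + 2 * D ^ 2 + ENNReal.ofReal A, { toDbl := hh, b_fin := fun j => by simp [bb], Kmeas := fun j => measurable_KK σ hmono j, Kup := ?_, Kdown := ?_, lbo := ?_, sumK := ?_ }⟩
  · intro j x
    rw [KK_eq, KK_eq]
    calc _ ≤ (σ (Bl x j))⁻¹ * ((1 + 2 * D ^ 2) * II σ k ((2:ℝ)^j) x) :=
          mul_le_mul' (ENNReal.inv_le_inv.2 (measure_mono (Bl_mono _ (by omega))))
            (II_succ_le h hk0 hmono x j)
      _ ≤ (σ (Bl x j))⁻¹ * ((1 + 2 * D ^ 2 + ENNReal.ofReal A) * II σ k ((2:ℝ)^j) x) := by gcongr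
      _ = _ := by ring
  · intro j x
    rw [KK_eq, KK_eq]
    calc _ ≤ ((1 + 2 * D ^ 2 + ENNReal.ofReal A) * (σ (Bl x (j+1)))⁻¹) * II σ k ((2:ℝ)^(j+1)) x :=
          mul_le_mul' (hh.inv_dbl x j) (II_mono _ _ (two_zpow_mono (by omega)) _)
      _ = _ := by ring
  · intro j x z hx
    refine (hL z ((2:ℝ)^j) (two_zpow_pos j) x hx z (self_mem_Bl z j)).trans ?_
    exact mul_le_mul' le_add_self le_rfl
  · intro x j s hs
    rw [KK_mul h]
    refine (sumK_aux h hk0 hmono x j s hs).trans (mul_le_mul' ?_ le_rfl)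
    refine le_trans ?_ hD2
    calc 2 * D = 2 * (D * 1) := by ring
      _ ≤ 2 * (D * D) := by gcongr
      _ = _ := by ring

end concrete
/-! ### Comparison of the continuous and dyadic objects -/

section compare

variable {n : ℕ} {σ : Measure (Euc n)} {k : ℝ → ℝ} {D : ℝ≥0∞}

lemma kbar_le (H : Hyp σ (bb k) (KK σ k) D) {j : ℤ} {r : ℝ} (hr : r ∈ Dy j) (x : Euc n) :
    kbar n σ k r x ≤ D * KK σ k (j+1) x := by
  rw [KK_eq]
  calc kbar n σ k r x ≤ (σ (Bl x j))⁻¹ * II σ k ((2:ℝ)^(j+1)) x :=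
        mul_le_mul' (ENNReal.inv_le_inv.2 (measure_mono (ball_subset_ball hr.1)))
          (II_mono _ _ hr.2.le _)
    _ ≤ (D * (σ (Bl x (j+1)))⁻¹) * II σ k ((2:ℝ)^(j+1)) x :=
        mul_le_mul' (H.toDbl.inv_dbl x j) le_rfl
    _ = _ := by ring

lemma le_kbar (H : Hyp σ (bb k) (KK σ k) D) {j : ℤ} {r : ℝ} (hr : r ∈ Dy j) (x : Euc n) :
    KK σ k j x ≤ D * kbar n σ k r x := by
  rw [KK_eq]
  calc _ ≤ (D * (σ (Bl x (j+1)))⁻¹) * II σ k r x :=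
        mul_le_mul' (H.toDbl.inv_dbl x j) (II_mono _ _ hr.1 _)
    _ = D * ((σ (Bl x (j+1)))⁻¹ * II σ k r x) := by ring
    _ ≤ _ := by
        refine mul_le_mul' le_rfl (mul_le_mul' (ENNReal.inv_le_inv.2 (measure_mono
          (ball_subset_ball hr.2.le))) le_rfl)

lemma WolffC_eq (σ : Measure (Euc n)) (k : ℝ → ℝ) (p : ℝ) (μ : Measure (Euc n)) (x : Euc n) :
    WolffC n σ k p μ x = ∑' j : ℤ, ∫⁻ r in Dy j, ENNReal.ofReal (k r / r) * (σ (ball x r) *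
      (∫⁻ y in ball x r, kbar n σ k r y ∂μ) ^ (p / (p - 1) - 1)) := by
  unfold WolffC
  rw [← iUnion_Dy, lintegral_iUnion measurableSet_Dy disj_Dy]
  simp only [mul_assoc]

lemma wolff_le (H : Hyp σ (bb k) (KK σ k) D) (hk0 : ∀ r ∈ Ioi (0:ℝ), 0 ≤ k r)
    (hmono : AntitoneOn k (Ioi (0:ℝ))) {p : ℝ} (hp : 0 ≤ p/(p-1) - 1) (μ : Measure (Euc n)) (x : Euc n) :
    WolffC n σ k p μ x ≤ (D ^ 2) ^ (p/(p-1)-1) * ∑' j : ℤ, bb k j * (σ (Bl x (j+1)) *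
      (KK σ k (j+1) x * μ (Bl x (j+1))) ^ (p/(p-1)-1)) := by
  rw [WolffC_eq, ← ENNReal.tsum_mul_left]
  refine ENNReal.tsum_le_tsum fun j => ?_
  refine (dy_le hk0 hmono j _ (σ (Bl x (j+1)) *
      (D ^ 2 * (KK σ k (j+1) x * μ (Bl x (j+1)))) ^ (p/(p-1)-1)) fun r hr => ?_).trans (le_of_eq ?_)
  · refine mul_le_mul' (measure_mono (ball_subset_ball hr.2.le)) (ENNReal.rpow_le_rpow ?_ hp)
    calc ∫⁻ y in ball x r, kbar n σ k r y ∂μ ≤ ∫⁻ y in Bl x (j+1), kbar n σ k r y ∂μ :=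
          lintegral_mono_set (ball_subset_ball hr.2.le)
      _ ≤ ∫⁻ y in Bl x (j+1), D * (D * KK σ k (j+1) x) ∂μ := by
          refine setLIntegral_mono' (measurableSet_Bl _ _) fun y hy => ?_
          exact (kbar_le H hr y).trans (mul_le_mul' le_rfl (H.lbo _ _ _ hy))
      _ = _ := by rw [setLIntegral_const]; ring
  · rw [ENNReal.mul_rpow_of_nonneg _ _ hp]; ring

lemma wolff_ge (H : Hyp σ (bb k) (KK σ k) D) (hk0 : ∀ r ∈ Ioi (0:ℝ), 0 ≤ k r)
    (hmono : AntitoneOn k (Ioi (0:ℝ))) {p : ℝ} (hp : 0 ≤ p/(p-1) - 1) (μ : Measure (Euc n)) (x : Euc n) :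
    ∑' j : ℤ, bb k j * (σ (Bl x (j-1)) *
      (KK σ k (j-1) x * μ (Bl x (j-1))) ^ (p/(p-1)-1)) ≤
      (2 * (D ^ 2) ^ (p/(p-1)-1)) * WolffC n σ k p μ x := by
  have hDt := H.ne_top
  rw [WolffC_eq, ← ENNReal.tsum_mul_left, ← (Equiv.addRight (1:ℤ)).tsum_eq]
  refine ENNReal.tsum_le_tsum fun j => ?_
  simp only [Equiv.coe_addRight, add_sub_cancel_right]
  have e : (2 * (D ^ 2) ^ (p/(p-1)-1)) * ∫⁻ r in Dy j, ENNReal.ofReal (k r / r) * (σ (ball x r) *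
      (∫⁻ y in ball x r, kbar n σ k r y ∂μ) ^ (p / (p - 1) - 1)) =
      2 * ∫⁻ r in Dy j, ENNReal.ofReal (k r / r) * (σ (ball x r) *
      (D ^ 2 * ∫⁻ y in ball x r, kbar n σ k r y ∂μ) ^ (p / (p - 1) - 1)) := by
    rw [mul_assoc, ← lintegral_const_mul' _ _ (ENNReal.rpow_ne_top_of_nonneg hp (by finiteness))]
    congr 1
    refine lintegral_congr fun r => ?_
    rw [ENNReal.mul_rpow_of_nonneg _ _ hp]; ring
  rw [e]
  refine dy_ge hk0 hmono j _ _ fun r hr => ?_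
  refine mul_le_mul' (measure_mono (ball_subset_ball hr.1)) (ENNReal.rpow_le_rpow ?_ hp)
  calc KK σ k j x * μ (Bl x j) = ∫⁻ y in Bl x j, KK σ k j x ∂μ := by rw [setLIntegral_const]
    _ ≤ ∫⁻ y in Bl x j, D ^ 2 * kbar n σ k r y ∂μ := by
        refine setLIntegral_mono' (measurableSet_Bl _ _) fun y hy => ?_
        refine (H.lbo _ _ _ (mem_Bl_comm.1 hy)).trans ?_
        refine (mul_le_mul' le_rfl (le_kbar H hr y)).trans (le_of_eq (by ring))
    _ = D ^ 2 * ∫⁻ y in Bl x j, kbar n σ k r y ∂μ := by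
        rw [lintegral_const_mul' _ _ (by finiteness)]
    _ ≤ _ := mul_le_mul' le_rfl (lintegral_mono_set (ball_subset_ball hr.1))

/-- potential with the truncated kernel -/
def TT (k : ℝ → ℝ) (μ : Measure (Euc n)) (x : Euc n) : ℝ≥0∞ := ∫⁻ y, ff k (dist x y) ∂μ

lemma measurable_ff_dist (hmono : AntitoneOn k (Ioi (0:ℝ))) :
    Measurable fun w : Euc n × Euc n => ff k (dist w.1 w.2) :=
  (measurable_ff hmono).comp (by fun_prop)

lemma measurable_TT (hmono : AntitoneOn k (Ioi (0:ℝ))) (μ : Measure (Euc n)) [SFinite μ] :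
    Measurable (TT k μ) :=
  (measurable_ff_dist hmono).lintegral_prod_right'

lemma energy_eq (h : Dbl σ D) (hn : 0 < n) (k : ℝ → ℝ) (p : ℝ) (μ : Measure (Euc n)) [SFinite μ] :
    energyC n σ k p μ = ∫⁻ x, TT k μ x ^ (p/(p-1)) ∂σ := by
  have hc : Set.Countable {x : Euc n | 0 < μ {x}} := by
    refine Measure.countable_meas_pos_of_disjoint_iUnion (fun x => measurableSet_singleton x) ?_
    intro x y hxy
    simpa [Function.onFun] using hxy
  have hz : σ {x : Euc n | 0 < μ {x}} = 0 :=
    (measure_null_iff_singleton hc).2 fun x _ => h.no_atom hn x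
  unfold energyC
  refine lintegral_congr_ae ?_
  have hae : ∀ᵐ x ∂σ, x ∉ {x : Euc n | 0 < μ {x}} := measure_eq_zero_iff_ae_notMem.1 hz
  filter_upwards [hae] with x hx
  congr 1
  unfold TT
  have hx0 : μ {x} = 0 := by
    simpa using hx
  refine lintegral_congr_ae ?_
  filter_upwards [measure_eq_zero_iff_ae_notMem.1 hx0] with y hy
  have : 0 < dist x y := dist_pos.2 fun h => hy (by simp [h])
  rw [ff, if_pos this]

lemma TT_le (hmono : AntitoneOn k (Ioi (0:ℝ))) (μ : Measure (Euc n)) (x : Euc n) :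
    TT k μ x ≤ ∑' j : ℤ, bb k j * μ (Bl x (j+1)) := by
  have h1 : ∀ y, ff k (dist x y) ≤ ∑' j : ℤ, (Bl x (j+1)).indicator (fun _ => bb k j) y := by
    intro y
    by_cases hd : 0 < dist x y
    · obtain ⟨j, hj⟩ := exists_Dy hd
      refine le_trans ?_ (ENNReal.le_tsum j)
      rw [indicator_of_mem (by rw [mem_Bl, dist_comm]; exact hj.2), ff, if_pos hd]
      exact ENNReal.ofReal_le_ofReal (hmono (two_zpow_pos j) hd hj.1)
    · rw [ff, if_neg hd]; exact zero_le
  calc TT k μ x ≤ ∫⁻ y, ∑' j : ℤ, (Bl x (j+1)).indicator (fun _ => bb k j) y ∂μ := lintegral_mono h1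
    _ = _ := by
        rw [lintegral_tsum fun j => (measurable_const.indicator (measurableSet_Bl _ _)).aemeasurable]
        refine tsum_congr fun j => ?_
        rw [lintegral_indicator (measurableSet_Bl _ _), setLIntegral_const]

lemma bb_le_ff (hmono : AntitoneOn k (Ioi (0:ℝ))) {w z : Euc n} {i : ℤ} (hz : z ∈ Ann w (i-1)) :
    bb k i ≤ ff k (dist z w) := by
  rw [mem_Ann, sub_add_cancel] at hz
  have hd : 0 < dist z w := (two_zpow_pos _).trans_le hz.1
  rw [ff, if_pos hd]
  exact ENNReal.ofReal_le_ofReal (hmono hd (two_zpow_pos _) hz.2.le)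

lemma II_le (H : Hyp σ (bb k) (KK σ k) D) (hn : 0 < n) (hk0 : ∀ r ∈ Ioi (0:ℝ), 0 ≤ k r)
    (hmono : AntitoneOn k (Ioi (0:ℝ))) (w : Euc n) (j : ℤ) :
    II σ k ((2:ℝ)^j) w ≤ D ^ 4 * ∫⁻ z in Bl w j, ff k (dist z w) ∂σ := by
  have hDt := H.ne_top
  have hsub : Ioo (0:ℝ) ((2:ℝ)^j) ⊆ ⋃ m : ℕ, Dy (j - 1 - m) := by
    intro s hs
    obtain ⟨i, hi⟩ := exists_Dy hs.1
    have : i < j := (zpow_lt_zpow_iff_right₀ (one_lt_two : (1:ℝ) < 2)).1 (hi.1.trans_lt hs.2)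
    refine mem_iUnion.2 ⟨(j - 1 - i).toNat, ?_⟩
    rwa [show j - 1 - ((j-1-i).toNat : ℤ) = i by omega]
  calc II σ k ((2:ℝ)^j) w ≤ ∑' m : ℕ, ∫⁻ s in Dy (j - 1 - m), ENNReal.ofReal (k s / s) * σ (ball w s) :=
        (lintegral_mono_set hsub).trans (lintegral_iUnion_le _ _)
    _ ≤ ∑' m : ℕ, D ^ 4 * ∫⁻ z in Ann w (j - 1 - m - 1), ff k (dist z w) ∂σ := by
        refine ENNReal.tsum_le_tsum fun m => ?_
        set i := j - 1 - (m:ℤ)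
        have h2 := dy_le hk0 hmono i (fun t => σ (ball w t)) (σ (Bl w (i+1)))
          (fun t ht => measure_mono (ball_subset_ball ht.2.le))
        have h3 := H.toDbl.ann hn w (i-1)
        rw [sub_add_cancel] at h3
        calc _ ≤ bb k i * σ (Bl w (i+1)) := h2
          _ ≤ bb k i * (D * (D ^ 3 * σ (Ann w (i-1)))) :=
              mul_le_mul' le_rfl ((H.dbl w i).trans (mul_le_mul' le_rfl h3))
          _ = D ^ 4 * ∫⁻ z in Ann w (i-1), bb k i ∂σ := by rw [setLIntegral_const]; ring
          _ ≤ _ := by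
              refine mul_le_mul' le_rfl (setLIntegral_mono' (measurableSet_Ann _ _) fun z hz => ?_)
              exact bb_le_ff hmono hz
    _ = D ^ 4 * ∫⁻ z in ⋃ m : ℕ, Ann w (j - 1 - m - 1), ff k (dist z w) ∂σ := by
        rw [ENNReal.tsum_mul_left, lintegral_iUnion (fun m => measurableSet_Ann _ _)]
        intro a c hac
        exact disj_Ann w (by omega)
    _ ≤ _ := by
        refine mul_le_mul' le_rfl (lintegral_mono_set (iUnion_subset fun m => ?_))
        exact sdiff_subset.trans (Bl_mono _ (by omega))

lemma Km_le (H : Hyp σ (bb k) (KK σ k) D) [SFinite σ] (hn : 0 < n) (hk0 : ∀ r ∈ Ioi (0:ℝ), 0 ≤ k r)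
    (hmono : AntitoneOn k (Ioi (0:ℝ))) (μ : Measure (Euc n)) [SFinite μ] {x y : Euc n} {j : ℤ}
    (hx : x ∈ Bl y j) : KK σ k j y * μ (Bl y j) ≤ D ^ 8 * Mx σ (TT k μ) x := by
  have hDt := H.ne_top
  set V := σ (Bl x (j+2)) with hV
  have hm : Measurable fun w : Euc n × Euc n => ff k (dist w.1 w.2) := measurable_ff_dist hmono
  have h1 : V * (KK σ k j y * μ (Bl y j)) ≤ D ^ 8 * ∫⁻ z in Bl x (j+2), TT k μ z ∂σ := by
    calc V * (KK σ k j y * μ (Bl y j)) = ∫⁻ w in Bl y j, V * KK σ k j y ∂μ := by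
          rw [setLIntegral_const]; ring
      _ ≤ ∫⁻ w in Bl y j, D ^ 8 * ∫⁻ z in Bl x (j+2), ff k (dist z w) ∂σ ∂μ := by
          refine setLIntegral_mono' (measurableSet_Bl _ _) fun w hw => ?_
          have a1 : V ≤ D ^ 3 * σ (Bl w j) := by
            refine (measure_mono ?_).trans (H.toDbl.shift w j 3)
            refine Bl_subset (j := j+1) ?_ _ (by push_cast; omega) (by push_cast; omega)
            exact mem_Bl_trans hx (mem_Bl_comm.1 hw) _ (by omega) (by omega)
          have a2 : KK σ k j y ≤ D * KK σ k j w := H.lbo _ _ _ (mem_Bl_comm.1 hw)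
          calc V * KK σ k j y ≤ (D ^ 3 * σ (Bl w j)) * (D * KK σ k j w) := mul_le_mul' a1 a2
            _ = D ^ 4 * (KK σ k j w * σ (Bl w j)) := by ring
            _ ≤ D ^ 4 * (D ^ 4 * ∫⁻ z in Bl w j, ff k (dist z w) ∂σ) := by
                rw [KK_mul H.toDbl]
                exact mul_le_mul' le_rfl (II_le H hn hk0 hmono w j)
            _ ≤ D ^ 4 * (D ^ 4 * ∫⁻ z in Bl x (j+2), ff k (dist z w) ∂σ) := by
                refine mul_le_mul' le_rfl (mul_le_mul' le_rfl (lintegral_mono_set ?_))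
                refine Bl_subset (j := j+1) ?_ _ (by omega) (by omega)
                exact mem_Bl_trans hw (mem_Bl_comm.1 hx) _ (by omega) (by omega)
            _ = _ := by ring
      _ = D ^ 8 * ∫⁻ z in Bl x (j+2), (∫⁻ w in Bl y j, ff k (dist z w) ∂μ) ∂σ := by
          rw [lintegral_const_mul' _ _ (by finiteness), lintegral_lintegral_swap]
          exact (hm.comp measurable_swap).aemeasurable
      _ ≤ _ := by
          refine mul_le_mul' le_rfl (lintegral_mono fun z => ?_)
          exact setLIntegral_le_lintegral _ _
  calc KK σ k j y * μ (Bl y j) = V⁻¹ * (V * (KK σ k j y * μ (Bl y j))) := by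
        rw [← mul_assoc, ENNReal.inv_mul_cancel (H.pos _ _) (H.fin _ _), one_mul]
    _ ≤ V⁻¹ * (D ^ 8 * ∫⁻ z in Bl x (j+2), TT k μ z ∂σ) := mul_le_mul' le_rfl h1
    _ = D ^ 8 * (V⁻¹ * ∫⁻ z in Bl x (j+2), TT k μ z ∂σ) := by ring
    _ ≤ _ := by
        refine mul_le_mul' le_rfl ?_
        exact le_iSup (fun l => (σ (Bl x l))⁻¹ * ∫⁻ z in Bl x l, TT k μ z ∂σ) (j+2)

lemma upper_aux (hmono : AntitoneOn k (Ioi (0:ℝ))) (μ : Measure (Euc n)) [SFinite μ] {q : ℝ}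
    (hqp : 0 < q) (x : Euc n) (M : ℝ≥0∞) :
    ∫⁻ y, ff k (dist x y) * M ^ (q-1) ∂μ = (TT k μ x ^ q) ^ (1/q) * (M ^ q) ^ (1 - 1/q) := by
  have hq0 : q ≠ 0 := hqp.ne'
  have hqe : q * (1 - 1/q) = q - 1 := by rw [mul_sub, mul_one, mul_one_div_cancel hq0]
  have hd : Measurable fun y : Euc n => dist x y := by fun_prop
  have hmx : Measurable fun y : Euc n => ff k (dist x y) := (measurable_ff hmono).comp hd
  have e1 : (TT k μ x ^ q) ^ (1/q) = TT k μ x := by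
    rw [← ENNReal.rpow_mul, mul_one_div_cancel hq0, ENNReal.rpow_one]
  have e2 : (M ^ q) ^ (1 - 1/q) = M ^ (q-1) := by
    rw [← ENNReal.rpow_mul, hqe]
  rw [e1, e2]
  exact lintegral_mul_const _ hmx

set_option maxHeartbeats 400000 in
lemma upper (H : Hyp σ (bb k) (KK σ k) D) [SFinite σ] (hn : 0 < n) (hk0 : ∀ r ∈ Ioi (0:ℝ), 0 ≤ k r)
    (hmono : AntitoneOn k (Ioi (0:ℝ))) {p : ℝ} (hp : 1 < p/(p-1)) :
    ∃ C : ℝ≥0∞, C ≠ ∞ ∧ ∀ (μ : Measure (Euc n)) [SFinite μ],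
      ∫⁻ x, WolffC n σ k p μ x ∂μ ≤ C * ∫⁻ x, TT k μ x ^ (p/(p-1)) ∂σ := by
  set q := p/(p-1) with hq
  have hq1 : 0 ≤ q - 1 := by linarith
  have hqp : 0 < q := by linarith
  have hq0 : q ≠ 0 := hqp.ne'
  have hqe : q * (1 - 1/q) = q - 1 := by rw [mul_sub, mul_one, mul_one_div_cancel hq0]
  have hDt := H.ne_top
  obtain ⟨Cs, hCs, hstrong⟩ := H.toDbl.strong hp
  have hr1 : 1/q ≤ 1 := by rw [div_le_one (by linarith)]; linarith
  have hCs' : Cs ^ (1 - 1/q) ≠ ∞ := ENNReal.rpow_ne_top_of_nonneg (by linarith) hCs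
  have hD2 : (D ^ 2) ^ (q-1) ≠ ∞ := ENNReal.rpow_ne_top_of_nonneg hq1 (by finiteness)
  have hD8 : (D ^ 8) ^ (q-1) ≠ ∞ := ENNReal.rpow_ne_top_of_nonneg hq1 (by finiteness)
  set C0 := (D ^ 2) ^ (q-1) * (D ^ 4 * (D ^ 8) ^ (q-1)) with hC0
  have hC0t : C0 ≠ ∞ := by finiteness
  refine ⟨C0 * Cs ^ (1 - 1/q), by finiteness, fun μ _ => ?_⟩
  have hTm := measurable_TT hmono μ
  have hMm := measurable_Mx (σ := σ) hTm
  set g : Euc n → ℝ≥0∞ := fun x => Mx σ (TT k μ) x ^ (q-1) with hg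
  have hgm : Measurable g := hMm.pow_const _
  have hm : Measurable fun w : Euc n × Euc n => ff k (dist w.1 w.2) := measurable_ff_dist hmono
  have key : ∀ y, WolffC n σ k p μ y ≤ C0 * ∫⁻ x, ff k (dist x y) * g x ∂σ := by
    intro y
    refine (wolff_le H hk0 hmono hq1 μ y).trans ?_
    rw [hC0, mul_assoc]
    refine mul_le_mul' le_rfl ?_
    calc ∑' j : ℤ, bb k j * (σ (Bl y (j+1)) * (KK σ k (j+1) y * μ (Bl y (j+1))) ^ (q-1))
        ≤ ∑' j : ℤ, (D ^ 4 * (D ^ 8) ^ (q-1)) * ∫⁻ x in Ann y (j-1), ff k (dist x y) * g x ∂σ := by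
          refine ENNReal.tsum_le_tsum fun j => ?_
          have h3 := H.toDbl.ann hn y (j-1)
          rw [sub_add_cancel] at h3
          set A := (KK σ k (j+1) y * μ (Bl y (j+1))) ^ (q-1) with hA
          calc bb k j * (σ (Bl y (j+1)) * A)
              ≤ bb k j * ((D * (D ^ 3 * σ (Ann y (j-1)))) * A) := by
                refine mul_le_mul' le_rfl (mul_le_mul' ?_ le_rfl)
                exact (H.dbl y j).trans (mul_le_mul' le_rfl h3)
            _ = D ^ 4 * ∫⁻ x in Ann y (j-1), bb k j * A ∂σ := by
                rw [setLIntegral_const]; ring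
            _ ≤ D ^ 4 * ∫⁻ x in Ann y (j-1), (D ^ 8) ^ (q-1) * (ff k (dist x y) * g x) ∂σ := by
                refine mul_le_mul' le_rfl (setLIntegral_mono' (measurableSet_Ann _ _) fun x hx => ?_)
                have hx' : x ∈ Bl y (j+1) := by
                  have := (mem_Ann.1 hx).2
                  rw [mem_Bl]
                  exact this.trans_le (two_zpow_mono (by omega))
                have hA2 : A ≤ (D ^ 8) ^ (q-1) * g x := by
                  rw [hA, hg, ← ENNReal.mul_rpow_of_nonneg _ _ hq1]
                  exact ENNReal.rpow_le_rpow (Km_le H hn hk0 hmono μ hx') hq1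
                calc bb k j * A ≤ ff k (dist x y) * ((D ^ 8) ^ (q-1) * g x) :=
                      mul_le_mul' (bb_le_ff hmono hx) hA2
                  _ = _ := by ring
            _ = _ := by
                rw [lintegral_const_mul' _ _ hD8]; ring
      _ = (D ^ 4 * (D ^ 8) ^ (q-1)) * ∫⁻ x in ⋃ j : ℤ, Ann y (j-1), ff k (dist x y) * g x ∂σ := by
          rw [ENNReal.tsum_mul_left, lintegral_iUnion (fun m => measurableSet_Ann _ _)]
          intro a c hac
          exact disj_Ann y (by omega)
      _ ≤ _ := mul_le_mul' le_rfl (setLIntegral_le_lintegral _ _)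
  clear_value C0 g q
  calc ∫⁻ y, WolffC n σ k p μ y ∂μ ≤ ∫⁻ y, C0 * ∫⁻ x, ff k (dist x y) * g x ∂σ ∂μ := lintegral_mono key
    _ = C0 * ∫⁻ x, (∫⁻ y, ff k (dist x y) * g x ∂μ) ∂σ := by
        rw [lintegral_const_mul' _ _ hC0t, lintegral_lintegral_swap]
        exact ((hm.comp measurable_swap).mul (hgm.comp measurable_snd)).aemeasurable
    _ = C0 * ∫⁻ x, (TT k μ x ^ q) ^ (1/q) * (Mx σ (TT k μ) x ^ q) ^ (1 - 1/q) ∂σ := by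
        rw [hg]
        exact congrArg (fun t => C0 * t) (lintegral_congr fun x => upper_aux hmono μ hqp x _)
    _ ≤ C0 * ((∫⁻ x, TT k μ x ^ q ∂σ) ^ (1/q) * (∫⁻ x, Mx σ (TT k μ) x ^ q ∂σ) ^ (1 - 1/q)) := by
        refine mul_le_mul' le_rfl ?_
        exact ENNReal.lintegral_mul_norm_pow_le (hTm.pow_const _).aemeasurable (hMm.pow_const _).aemeasurable
          (one_div_pos.2 hqp).le (sub_nonneg.2 hr1) (add_sub_cancel _ _)
    _ ≤ C0 * ((∫⁻ x, TT k μ x ^ q ∂σ) ^ (1/q) * (Cs * ∫⁻ x, TT k μ x ^ q ∂σ) ^ (1 - 1/q)) := by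
        refine mul_le_mul' le_rfl (mul_le_mul' le_rfl (ENNReal.rpow_le_rpow ?_ (sub_nonneg.2 hr1)))
        exact hstrong _ hTm
    _ = C0 * Cs ^ (1 - 1/q) * ((∫⁻ x, TT k μ x ^ q ∂σ) ^ (1/q) *
          (∫⁻ x, TT k μ x ^ q ∂σ) ^ (1 - 1/q)) := by
        rw [ENNReal.mul_rpow_of_nonneg _ _ (sub_nonneg.2 hr1)]
        generalize (∫⁻ x, TT k μ x ^ q ∂σ) ^ (1/q) = a
        generalize (∫⁻ x, TT k μ x ^ q ∂σ) ^ (1 - 1/q) = b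
        generalize Cs ^ (1 - 1/q) = c
        rw [mul_left_comm a c b, mul_assoc C0]
    _ = _ := by
        rw [← ENNReal.rpow_add_of_nonneg _ _ (one_div_pos.2 hqp).le (sub_nonneg.2 hr1),
          add_sub_cancel, ENNReal.rpow_one]

end compare
section final

variable {n : ℕ} {σ : Measure (Euc n)} {k : ℝ → ℝ} {D : ℝ≥0∞}

lemma exists_Bl_zero (x : Euc n) : ∃ L : ℕ, x ∈ Bl (0 : Euc n) L := by
  obtain ⟨N, hN⟩ := pow_unbounded_of_one_lt (dist x 0) (one_lt_two : (1:ℝ) < 2)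
  exact ⟨N, by rw [mem_Bl, zpow_natCast]; exact hN⟩

lemma tsum_le_iSup_SS (b : ℤ → ℝ≥0∞) (μ : Measure (Euc n)) (x : Euc n) :
    ∑' j : ℤ, b j * μ (Bl x (j+1)) ≤
      ⨆ L : ℕ, SS b (μ.restrict (Bl 0 L)) (Finset.Icc (-(L:ℤ)) L) 1 x := by
  rw [ENNReal.tsum_eq_iSup_sum]
  refine iSup_le fun t => ?_
  obtain ⟨L0, hL0⟩ := exists_Bl_zero x
  obtain ⟨N, hN⟩ : ∃ N : ℕ, ∀ i ∈ t, i.natAbs ≤ N :=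
    ⟨t.sup Int.natAbs, fun i hi => Finset.le_sup (f := Int.natAbs) hi⟩
  refine le_trans ?_ (le_iSup _ (N + L0 + 2))
  unfold SS
  calc ∑ j ∈ t, b j * μ (Bl x (j+1))
      = ∑ j ∈ t, b j * (μ.restrict (Bl 0 ((N + L0 + 2 : ℕ) : ℤ))) (Bl x (j+1)) := by
        refine Finset.sum_congr rfl fun j hj => ?_
        have := hN j hj
        rw [Measure.restrict_apply (measurableSet_Bl _ _), inter_eq_self_of_subset_left]
        apply Bl_subset hL0 <;> push_cast <;> omega
    _ ≤ _ := by
        refine Finset.sum_le_sum_of_subset fun j hj => ?_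
        have := hN j hj
        rw [Finset.mem_Icc]
        push_cast
        omega

lemma lower_main (H : Hyp σ (bb k) (KK σ k) D) [SFinite σ] (hk0 : ∀ r ∈ Ioi (0:ℝ), 0 ≤ k r)
    (hmono : AntitoneOn k (Ioi (0:ℝ))) {p : ℝ} (hp : 1 < p/(p-1)) :
    ∃ C : ℝ≥0∞, C ≠ ∞ ∧ ∀ (μ : Measure (Euc n)) [IsLocallyFiniteMeasure μ] [SFinite μ],
      ∫⁻ x, TT k μ x ^ (p/(p-1)) ∂σ ≤ C * ∫⁻ x, WolffC n σ k p μ x ∂μ := by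
  set q := p/(p-1) with hq
  have hq1 : 0 ≤ q - 1 := by linarith
  have hDt := H.ne_top
  obtain ⟨C1, hC1, h1⟩ := H.lower hp
  obtain ⟨C2, hC2, h2⟩ := H.phi 4 hp
  have hD2 : (D ^ 2) ^ (q-1) ≠ ∞ := ENNReal.rpow_ne_top_of_nonneg hq1 (by finiteness)
  have hD1 : D ^ (q-1) ≠ ∞ := ENNReal.rpow_ne_top_of_nonneg hq1 (by finiteness)
  set C3 := (D ^ 2) ^ (q-1) * (C2 * D ^ (q-1)) with hC3
  have hC3t : C3 ≠ ∞ := by finiteness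
  refine ⟨C1 * (C3 * (2 * (D ^ 2) ^ (q-1))), by finiteness, fun μ _ _ => ?_⟩
  set ν : ℕ → Measure (Euc n) := fun L => μ.restrict (Bl 0 L) with hν
  set s : ℕ → Finset ℤ := fun L => Finset.Icc (-(L:ℤ)) L with hs
  have hνle : ∀ L, ν L ≤ μ := fun L => Measure.restrict_le_self
  have hfin : ∀ L, IsFiniteMeasure (ν L) := fun L =>
    ⟨by rw [hν, Measure.restrict_apply_univ]; unfold Bl; exact measure_ball_lt_top⟩
  -- the bound for each L
  have hL : ∀ L, ∫⁻ x, SS (bb k) (ν L) (s L) 1 x ^ q ∂σ ≤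
      C1 * (C3 * (2 * (D ^ 2) ^ (q-1))) * ∫⁻ x, WolffC n σ k p μ x ∂μ := by
    intro L
    have := hfin L
    have hc : ν L (Bl 0 L)ᶜ = 0 := by
      rw [hν]
      dsimp only
      rw [Measure.restrict_apply (measurableSet_Bl _ _).compl]
      simp
    refine (h1 (ν L) L hc (s L)).trans ?_
    rw [mul_assoc]
    refine mul_le_mul' le_rfl ?_
    have hm : ∀ j : ℤ, Measurable fun x => σ (Bl x (j-1)) *
      (KK σ k (j-1) x * μ (Bl x (j-1))) ^ (q-1) := fun j =>
      (measurable_Bl σ _).mul (((H.Kmeas _).mul (measurable_Bl μ _)).pow_const _)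
    have hj : ∀ j : ℤ, ∫⁻ x, KK σ k j x ^ (q-1) * ν L (Bl x (j+2)) ^ q ∂σ ≤
        C3 * ∫⁻ x, σ (Bl x (j-1)) * (KK σ k (j-1) x * μ (Bl x (j-1))) ^ (q-1) ∂μ := by
      intro j
      have e1 : j = (j-2) + ((2:ℕ):ℤ) := by push_cast; ring
      have e2 : j + 2 = (j-2) + ((4:ℕ):ℤ) := by push_cast; ring
      have e3 : j - 2 + 1 = j - 1 := by ring
      calc ∫⁻ x, KK σ k j x ^ (q-1) * ν L (Bl x (j+2)) ^ q ∂σ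
          ≤ ∫⁻ x, (D ^ 2) ^ (q-1) * (KK σ k (j-2) x ^ (q-1) * ν L (Bl x (j-2+(4:ℕ))) ^ q) ∂σ := by
            refine lintegral_mono fun x => ?_
            rw [← mul_assoc, ← ENNReal.mul_rpow_of_nonneg _ _ hq1, e2]
            refine mul_le_mul' (ENNReal.rpow_le_rpow ?_ hq1) le_rfl
            have := H.K_up (j-2) 2 x
            rwa [← e1] at this
        _ = (D ^ 2) ^ (q-1) * ∫⁻ x, KK σ k (j-2) x ^ (q-1) * ν L (Bl x (j-2+(4:ℕ))) ^ q ∂σ := by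
            rw [lintegral_const_mul' _ _ hD2]
        _ ≤ (D ^ 2) ^ (q-1) * (C2 * ∫⁻ y, σ (Bl y (j-2)) *
              (KK σ k (j-2) y * ν L (Bl y (j-2+1))) ^ (q-1) ∂(ν L)) := by
            refine mul_le_mul' le_rfl (h2 (ν L) (j-2))
        _ ≤ (D ^ 2) ^ (q-1) * (C2 * ∫⁻ y, D ^ (q-1) * (σ (Bl y (j-1)) *
              (KK σ k (j-1) y * μ (Bl y (j-1))) ^ (q-1)) ∂μ) := by
            refine mul_le_mul' le_rfl (mul_le_mul' le_rfl ?_)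
            refine lintegral_mono' (hνle L) fun y => ?_
            calc σ (Bl y (j-2)) * (KK σ k (j-2) y * ν L (Bl y (j-2+1))) ^ (q-1)
                ≤ σ (Bl y (j-1)) * ((D * KK σ k (j-1) y) * μ (Bl y (j-1))) ^ (q-1) := by
                  rw [e3]
                  refine mul_le_mul' (measure_mono (Bl_mono _ (by omega)))
                    (ENNReal.rpow_le_rpow (mul_le_mul' ?_ (hνle L _)) hq1)
                  have := H.Kdown (j-2) y
                  rwa [e3] at this
              _ = _ := by
                  rw [mul_assoc, ENNReal.mul_rpow_of_nonneg _ _ hq1]; ring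
        _ = _ := by
            rw [lintegral_const_mul' _ _ hD1]; ring
    calc ∑ j ∈ s L, bb k j * ∫⁻ x, KK σ k j x ^ (q-1) * ν L (Bl x (j+2)) ^ q ∂σ
        ≤ ∑ j ∈ s L, bb k j * (C3 * ∫⁻ x, σ (Bl x (j-1)) *
            (KK σ k (j-1) x * μ (Bl x (j-1))) ^ (q-1) ∂μ) :=
          Finset.sum_le_sum fun j _ => mul_le_mul' le_rfl (hj j)
      _ = C3 * ∫⁻ x, ∑ j ∈ s L, bb k j * (σ (Bl x (j-1)) *
            (KK σ k (j-1) x * μ (Bl x (j-1))) ^ (q-1)) ∂μ := by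
          rw [lintegral_finsetSum _ fun j _ => (hm j).const_mul _, Finset.mul_sum]
          refine Finset.sum_congr rfl fun j _ => ?_
          rw [lintegral_const_mul' _ _ (H.b_fin j)]
          ring
      _ ≤ C3 * ∫⁻ x, (2 * (D ^ 2) ^ (q-1)) * WolffC n σ k p μ x ∂μ := by
          refine mul_le_mul' le_rfl (lintegral_mono fun x => ?_)
          exact (ENNReal.sum_le_tsum _).trans (wolff_ge H hk0 hmono hq1 μ x)
      _ = _ := by
          rw [lintegral_const_mul' _ _ (by finiteness)]; ring
  have hmonoL : Monotone fun L => SS (bb k) (ν L) (s L) 1 := by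
    intro L L' hLL x
    have hLL' : (L:ℤ) ≤ L' := by exact_mod_cast hLL
    unfold SS
    calc ∑ i ∈ s L, bb k i * ν L (Bl x (i+1)) ≤ ∑ i ∈ s L, bb k i * ν L' (Bl x (i+1)) := by
          refine Finset.sum_le_sum fun i _ => mul_le_mul' le_rfl ?_
          exact Measure.restrict_mono (Bl_mono _ hLL') le_rfl _
      _ ≤ _ := Finset.sum_le_sum_of_subset (Finset.Icc_subset_Icc (by omega) hLL')
  calc ∫⁻ x, TT k μ x ^ q ∂σ ≤ ∫⁻ x, ⨆ L : ℕ, SS (bb k) (ν L) (s L) 1 x ^ q ∂σ := by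
        refine lintegral_mono fun x => ?_
        have e := (ENNReal.orderIsoRpow q (by linarith)).map_iSup
          (fun L : ℕ => SS (bb k) (ν L) (s L) 1 x)
        simp only [ENNReal.orderIsoRpow_apply] at e
        rw [← e]
        exact ENNReal.rpow_le_rpow ((TT_le hmono μ x).trans (tsum_le_iSup_SS _ _ _)) (by linarith)
    _ = ⨆ L : ℕ, ∫⁻ x, SS (bb k) (ν L) (s L) 1 x ^ q ∂σ := by
        refine lintegral_iSup (fun L => ?_) ?_
        · have := hfin L
          exact (measurable_SS (ν L) _ 1).pow_const _
        · intro L L' hLL x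
          exact ENNReal.rpow_le_rpow (hmonoL hLL x) (by linarith)
    _ ≤ _ := iSup_le hL

end final

theorem stmt18 (n : ℕ) (hn : 0 < n) (k : ℝ → ℝ)
    (hk0 : ∀ r ∈ Ioi (0:ℝ), 0 ≤ k r) (hmono : AntitoneOn k (Ioi (0:ℝ)))
    (hlsc : LowerSemicontinuousOn k (Ioi (0:ℝ)))
    (p : ℝ) (hp : 1 < p)
    (σ : Measure (Euc n)) [IsLocallyFiniteMeasure σ]
    (hσ : Doubling n σ) (hLBO : LBO n σ k) :
    ∃ C₁ C₂ : ℝ, 0 < C₁ ∧ 0 < C₂ ∧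
      ∀ (μ : Measure (Euc n)), IsLocallyFiniteMeasure μ →
        ENNReal.ofReal C₁ * energyC n σ k p μ ≤ (∫⁻ x, WolffC n σ k p μ x ∂μ) ∧
        (∫⁻ x, WolffC n σ k p μ x ∂μ) ≤ ENNReal.ofReal C₂ * energyC n σ k p μ := by
  have hp1 : 0 < p - 1 := by linarith
  have hq : 1 < p / (p-1) := by rw [lt_div_iff₀ hp1]; linarith
  rcases Dbl_of_Doubling hσ with h0 | ⟨D, hD⟩
  · subst h0
    refine ⟨1, 1, one_pos, one_pos, fun μ _ => ?_⟩
    simp [energyC, WolffC]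
  obtain ⟨D', H⟩ := exists_Hyp hD hk0 hmono hLBO
  obtain ⟨CL, hCL, hlow⟩ := lower_main H hk0 hmono hq
  obtain ⟨CU, hCU, hup⟩ := upper H hn hk0 hmono hq
  refine ⟨(CL.toReal + 1)⁻¹, CU.toReal + 1, by positivity, by positivity, fun μ hμ => ?_⟩
  rw [energy_eq hD hn]
  have hle : ∀ C : ℝ≥0∞, C ≠ ∞ → C ≤ ENNReal.ofReal (C.toReal + 1) := by
    intro C hC
    conv_lhs => rw [← ENNReal.ofReal_toReal hC]
    exact ENNReal.ofReal_le_ofReal (by linarith)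
  constructor
  · have h1 : ENNReal.ofReal (CL.toReal + 1) ≠ 0 := by
      rw [Ne, ENNReal.ofReal_eq_zero, not_le]; positivity
    rw [ENNReal.ofReal_inv_of_pos (by positivity)]
    calc _ ≤ (ENNReal.ofReal (CL.toReal + 1))⁻¹ * (ENNReal.ofReal (CL.toReal + 1) *
          ∫⁻ x, WolffC n σ k p μ x ∂μ) :=
          mul_le_mul' le_rfl ((hlow μ).trans (mul_le_mul' (hle CL hCL) le_rfl))
      _ = _ := by
          rw [← mul_assoc, ENNReal.inv_mul_cancel h1 ENNReal.ofReal_ne_top, one_mul]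
  · exact (hup μ).trans (mul_le_mul' (hle CU hCU) le_rfl)
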